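/- arXiv:1311.6185 — 6 statements merged into one kernel-verified Lean document; each statement's English description precedes it below -/
import Mathlib

section
/- For every t ≥ 0 and every ξ ∈ ℝ with |ξ| < 1/2, one has 0 ≤ K̂₀(t,ξ) ≤ exp(−tξ²) and 0 ≤ K̂₁(t,ξ) ≤ t·exp(−tξ²). -/
noncomputable section

/-- Low-frequency kernel `K̂₀(t,ξ)` for `|ξ| < 1/2`. -/
def K0low (t ξ : ℝ) : ℝ :=
  (1/2) * (Real.exp ((-1/2 + Real.sqrt (1/4 - ξ^2)) * t) +
           Real.exp ((-1/2 - Real.sqrt (1/4 - ξ^2)) * t))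

/-- Low-frequency kernel `K̂₁(t,ξ)` for `|ξ| < 1/2`. -/
def K1low (t ξ : ℝ) : ℝ :=
  (Real.exp ((-1/2 + Real.sqrt (1/4 - ξ^2)) * t) -
   Real.exp ((-1/2 - Real.sqrt (1/4 - ξ^2)) * t)) / (2 * Real.sqrt (1/4 - ξ^2))

/-- For `t ≥ 0` and `|ξ| < 1/2`: `0 ≤ K̂₀(t,ξ) ≤ exp(-tξ²)` and
`0 ≤ K̂₁(t,ξ) ≤ t·exp(-tξ²)`. -/
theorem kernel_pointwise_bounds_low (t ξ : ℝ) (ht : 0 ≤ t) (hξ : |ξ| < 1/2) :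
    0 ≤ K0low t ξ ∧ K0low t ξ ≤ Real.exp (-t * ξ^2) ∧
    0 ≤ K1low t ξ ∧ K1low t ξ ≤ t * Real.exp (-t * ξ^2) := by
  have hpos : 0 < 1/4 - ξ^2 := by
    have := abs_lt.mp hξ
    nlinarith [this.1, this.2]
  unfold K0low K1low
  have hb : 0 < Real.sqrt (1/4 - ξ^2) := Real.sqrt_pos.mpr hpos
  have hsq : Real.sqrt (1/4 - ξ^2) ^ 2 = 1/4 - ξ^2 := Real.sq_sqrt hpos.le
  generalize Real.sqrt (1/4 - ξ^2) = b at hb hsq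
  have hbt : 0 ≤ b * t := mul_nonneg hb.le ht
  have h1 : Real.exp ((-1/2 + b) * t) ≤ Real.exp (-t * ξ^2) := by
    apply Real.exp_le_exp.mpr
    have hx : ξ^2 = 1/4 - b^2 := by linarith
    rw [hx]
    nlinarith [mul_nonneg ht (sq_nonneg (1/2 - b))]
  have h2 : Real.exp ((-1/2 - b) * t) ≤ Real.exp ((-1/2 + b) * t) := by
    apply Real.exp_le_exp.mpr
    nlinarith
  have h3 : Real.exp ((-1/2 - b) * t)
      = Real.exp ((-1/2 + b) * t) * Real.exp (-(2 * b * t)) := by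
    rw [← Real.exp_add]
    congr 1
    ring
  have h4 : 1 - 2 * b * t ≤ Real.exp (-(2 * b * t)) := by
    linarith [Real.add_one_le_exp (-(2 * b * t))]
  refine ⟨by positivity, by linarith, div_nonneg (by linarith) (by linarith), ?_⟩
  rw [div_le_iff₀ (by linarith), h3]
  have h5 := mul_le_mul_of_nonneg_left h4 (Real.exp_pos ((-1/2 + b) * t)).le
  have h6 := mul_le_mul_of_nonneg_right h1 (by linarith : 0 ≤ 2 * (b * t))
  nlinarith

end
end

section
/- There exists a constant C > 0 such that for every t ≥ 0 and every ξ ∈ ℝ with |ξ| < 1/2, the time derivatives of the kernels satisfy |∂ₜK̂₀(t,ξ)| ≤ C·(ξ²·exp(−tξ²) + exp(−t/4)) and |∂ₜK̂₁(t,ξ)| ≤ C·(ξ²·exp(−tξ²) + exp(−t/4)), where ∂ₜ denotes the derivative with respect to t at fixed ξ. -/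
noncomputable section

/-- There is `C > 0` such that for all `t ≥ 0` and `|ξ| < 1/2`,
`|∂ₜK̂ᵢ(t,ξ)| ≤ C·(ξ²·exp(-tξ²) + exp(-t/4))` for `i = 0, 1`. -/
theorem kernel_time_deriv_bounds_low :
    ∃ C : ℝ, 0 < C ∧ ∀ t : ℝ, 0 ≤ t → ∀ ξ : ℝ, |ξ| < 1/2 →
      |deriv (fun s => K0low s ξ) t| ≤ C * (ξ^2 * Real.exp (-t * ξ^2) + Real.exp (-t/4)) ∧
      |deriv (fun s => K1low s ξ) t| ≤ C * (ξ^2 * Real.exp (-t * ξ^2) + Real.exp (-t/4)) := by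
  refine ⟨8, by norm_num, ?_⟩
  intro t ht ξ hξ
  have hx : ξ ^ 2 < 1 / 4 := by
    have := sq_lt_sq' (abs_lt.mp hξ).1 (abs_lt.mp hξ).2
    norm_num at this ⊢
    exact this
  have hx0 : 0 ≤ ξ ^ 2 := sq_nonneg ξ
  unfold K0low K1low
  have hb : 0 < Real.sqrt (1 / 4 - ξ ^ 2) := Real.sqrt_pos.mpr (by linarith)
  have hbsq : Real.sqrt (1 / 4 - ξ ^ 2) ^ 2 = 1 / 4 - ξ ^ 2 := Real.sq_sqrt (by linarith)
  generalize Real.sqrt (1 / 4 - ξ ^ 2) = b at hb hbsq ⊢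
  generalize ξ ^ 2 = x at hx hx0 hbsq ⊢
  have hb2 : b ≤ 1 / 2 := by nlinarith
  have hd : ∀ c : ℝ, HasDerivAt (fun s : ℝ => Real.exp (c * s)) (Real.exp (c * t) * c) t := by
    intro c
    have := ((hasDerivAt_id t).const_mul c).exp
    simpa using this
  have h0 := (((hd (-1/2 + b)).fun_add (hd (-1/2 - b))).const_mul (1/2)).deriv
  have h1 := (((hd (-1/2 + b)).fun_sub (hd (-1/2 - b))).div_const (2 * b)).deriv
  rw [h0, h1]
  have hl1 : x ≤ 1 / 2 - b := by nlinarith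
  have hl2 : 1 / 2 - b ≤ 2 * x := by nlinarith
  have hp : Real.exp ((-1/2 + b) * t) ≤ Real.exp (-t * x) := by
    apply Real.exp_le_exp.mpr; nlinarith
  have hq : Real.exp ((-1/2 - b) * t) ≤ Real.exp (-t / 4) := by
    apply Real.exp_le_exp.mpr; nlinarith [mul_nonneg hb.le ht]
  have hqp : Real.exp ((-1/2 - b) * t) ≤ Real.exp ((-1/2 + b) * t) := by
    apply Real.exp_le_exp.mpr; nlinarith [mul_nonneg hb.le ht]
  have hqp2 : Real.exp ((-1/2 + b) * t) * (1 - 2 * b * t) ≤ Real.exp ((-1/2 - b) * t) := by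
    have e : (-1/2 - b) * t = (-1/2 + b) * t + (-(2 * b * t)) := by ring
    rw [e, Real.exp_add]
    apply mul_le_mul_of_nonneg_left _ (Real.exp_pos _).le
    linarith [Real.add_one_le_exp (-(2 * b * t))]
  have hp8 : b ≤ 1 / 8 → Real.exp ((-1/2 + b) * t) * (1 + t / 2) ≤ 4 * Real.exp (-t / 4) := by
    intro h
    have h2 : Real.exp ((-1/2 + b) * t) * Real.exp (t / 8) ≤ Real.exp (-t / 4) := by
      rw [← Real.exp_add]
      apply Real.exp_le_exp.mpr; nlinarith
    have h3 : 1 + t / 2 ≤ 4 * Real.exp (t / 8) := by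
      linarith [Real.add_one_le_exp (t / 8)]
    nlinarith [mul_le_mul_of_nonneg_left h3 (Real.exp_pos ((-1/2 + b) * t)).le]
  have hP := Real.exp_pos ((-1/2 + b) * t)
  have hQ := Real.exp_pos ((-1/2 - b) * t)
  have hE := Real.exp_pos (-t * x)
  have hF := Real.exp_pos (-t / 4)
  generalize Real.exp ((-1/2 + b) * t) = p at *
  generalize Real.exp ((-1/2 - b) * t) = q at *
  generalize Real.exp (-t * x) = E at *
  generalize Real.exp (-t / 4) = F at *
  have hxE : 0 ≤ x * E := mul_nonneg hx0 hE.le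
  have a1 : p * (1 / 2 - b) ≤ 2 * (x * E) := by
    calc p * (1 / 2 - b) ≤ E * (2 * x) := mul_le_mul hp hl2 (by linarith) hE.le
      _ = _ := by ring
  have a0 : 0 ≤ p * (1 / 2 - b) := mul_nonneg hP.le (by linarith)
  have c1 : q * (1 / 2 + b) ≤ F := by nlinarith
  have c0 : 0 ≤ q * (1 / 2 + b) := by positivity
  constructor
  · rw [abs_le]; constructor <;> nlinarith
  · rw [abs_div, abs_of_pos (by linarith : 0 < 2 * b), div_le_iff₀ (by linarith)]
    by_cases h : b ≤ 1 / 8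
    · have h8 := mul_le_mul_of_nonneg_left (hp8 h) hb.le
      have hbx : 0 ≤ b * (x * E) := mul_nonneg hb.le hxE
      have hbF : 0 ≤ b * F := mul_nonneg hb.le hF.le
      have hbq : b * q ≤ b * p := mul_le_mul_of_nonneg_left hqp hb.le
      have hbq0 : 0 ≤ b * q := by positivity
      have hbpt : 0 ≤ b * p * t := by positivity
      rw [abs_le]; constructor <;> nlinarith
    · have h4 : (2 * (x * E) + F) ≤ 8 * (x * E + F) * (2 * b) := by
        have : 0 ≤ (x * E + F) * (b - 1 / 8) := mul_nonneg (by linarith) (by linarith)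
        nlinarith
      rw [abs_le]; constructor <;> nlinarith


end
end

section
/- For every α ≥ 0 there exists a constant C > 0 (depending only on α) such that for all t ≥ 0 and all q ∈ [1,∞], the L^q norm over the set {ξ ∈ ℝ : |ξ| < 1/2} of the function ξ ↦ |ξ|^α·K̂₀(t,ξ) is at most C·(1+t)^{−(1/q + α)/2} (with the convention 1/∞ = 0, the case q = ∞ being the essential supremum). -/
open MeasureTheory
open scoped ENNReal

noncomputable section

lemma K0low_nonneg (t ξ : ℝ) : 0 ≤ K0low t ξ := by
  unfold K0low; positivity

lemma K0low_le (t ξ : ℝ) (ht : 0 ≤ t) (hξ : |ξ| < 1/2) :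
    K0low t ξ ≤ Real.exp (1/4) * Real.exp (-ξ^2 * (1 + t)) := by
  have h2 : ξ^2 ≤ 1/4 := by
    have := abs_lt.mp hξ
    nlinarith
  have h0 := Real.sqrt_nonneg (1/4 - ξ^2)
  have h1 : Real.sqrt (1/4 - ξ^2) ≤ 1/2 - ξ^2 := by
    apply Real.sqrt_le_iff.mpr
    constructor
    · linarith
    · nlinarith [sq_nonneg (ξ^2)]
  have e1 : Real.exp ((-1/2 + Real.sqrt (1/4 - ξ^2)) * t) ≤ Real.exp (-ξ^2 * t) := by
    apply Real.exp_le_exp.mpr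
    apply mul_le_mul_of_nonneg_right _ ht
    linarith
  have e2 : Real.exp ((-1/2 - Real.sqrt (1/4 - ξ^2)) * t) ≤ Real.exp (-ξ^2 * t) := by
    apply Real.exp_le_exp.mpr
    apply mul_le_mul_of_nonneg_right _ ht
    linarith
  have e3 : Real.exp (-ξ^2 * t) ≤ Real.exp (1/4) * Real.exp (-ξ^2 * (1 + t)) := by
    rw [← Real.exp_add]
    apply Real.exp_le_exp.mpr
    linarith
  unfold K0low
  linarith

lemma rpow_mul_gauss_le (α : ℝ) (hα : 0 ≤ α) (y : ℝ) (hy : 0 ≤ y) :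
    y ^ α ≤ Real.exp (α^2/2) * Real.exp (y^2/2) := by
  have h1 : y ≤ Real.exp y := by linarith [Real.add_one_le_exp y]
  calc y ^ α ≤ (Real.exp y) ^ α := Real.rpow_le_rpow hy h1 hα
    _ = Real.exp (y * α) := (Real.exp_mul y α).symm
    _ ≤ _ := by
      rw [← Real.exp_add]
      apply Real.exp_le_exp.mpr
      nlinarith [sq_nonneg (y - α)]

lemma pointwise_bound (α : ℝ) (hα : 0 ≤ α) (t ξ : ℝ) (ht : 0 ≤ t) (hξ : |ξ| < 1/2) :
    |ξ| ^ α * K0low t ξ ≤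
      (Real.exp (1/4) * Real.exp (α^2/2) * (1 + t) ^ (-α/2)) *
        Real.exp (-((1 + t)/2) * ξ^2) := by
  have hs : 0 < 1 + t := by linarith
  have h1 := rpow_mul_gauss_le α hα (|ξ| * Real.sqrt (1 + t)) (by positivity)
  rw [Real.mul_rpow (abs_nonneg _) (Real.sqrt_nonneg _), mul_pow, Real.sq_sqrt hs.le, sq_abs,
    Real.sqrt_eq_rpow, ← Real.rpow_mul hs.le] at h1
  have h2 : |ξ| ^ α ≤ Real.exp (α^2/2) * Real.exp (ξ^2 * (1+t)/2) * (1 + t) ^ (-α/2) := by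
    have h3 : (1 + t) ^ (1/2 * α) * (1 + t) ^ (-α/2) = 1 := by
      rw [← Real.rpow_add hs, show 1/2 * α + -α/2 = 0 by ring, Real.rpow_zero]
    calc |ξ| ^ α = (|ξ| ^ α * (1 + t) ^ (1/2 * α)) * (1 + t) ^ (-α/2) := by
          rw [mul_assoc, h3, mul_one]
      _ ≤ _ := mul_le_mul_of_nonneg_right h1 (by positivity)
  calc |ξ| ^ α * K0low t ξ
      ≤ (Real.exp (α^2/2) * Real.exp (ξ^2 * (1+t)/2) * (1 + t) ^ (-α/2)) *
        (Real.exp (1/4) * Real.exp (-ξ^2 * (1 + t))) :=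
        mul_le_mul h2 (K0low_le t ξ ht hξ) (K0low_nonneg _ _) (by positivity)
    _ = (Real.exp (1/4) * Real.exp (α^2/2) * (1 + t) ^ (-α/2)) *
        (Real.exp (ξ^2 * (1+t)/2) * Real.exp (-ξ^2 * (1 + t))) := by ring
    _ = _ := by
      rw [← Real.exp_add (ξ^2 * (1+t)/2)]
      congr 2
      ring

lemma one_le_sqrt_two_pi : 1 ≤ Real.sqrt (2 * Real.pi) := by
  rw [Real.one_le_sqrt]
  linarith [Real.pi_gt_three]

lemma gauss_eLpNorm (s : ℝ) (hs : 0 < s) (q : ℝ≥0∞) (hq : 1 ≤ q) :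
    eLpNorm (fun ξ : ℝ => Real.exp (-(s/2) * ξ^2)) q volume ≤
      ENNReal.ofReal (Real.sqrt (2 * Real.pi) * s ^ (-q⁻¹.toReal/2)) := by
  by_cases hqt : q = ∞
  · subst hqt
    rw [eLpNorm_exponent_top]
    refine eLpNormEssSup_le_of_ae_bound (Filter.Eventually.of_forall fun ξ => ?_)
    rw [Real.norm_of_nonneg (Real.exp_pos _).le]
    have h1 : Real.exp (-(s/2) * ξ^2) ≤ 1 := Real.exp_le_one_iff.mpr (by
      nlinarith [mul_nonneg hs.le (sq_nonneg ξ)])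
    simpa using h1.trans one_le_sqrt_two_pi
  · have hq0 : q ≠ 0 := (zero_lt_one.trans_le hq).ne'
    have hp1 : 1 ≤ q.toReal := by
      simpa using (ENNReal.toReal_le_toReal ENNReal.one_ne_top hqt).mpr hq
    rw [eLpNorm_eq_lintegral_rpow_enorm_toReal hq0 hqt, ENNReal.toReal_inv]
    generalize q.toReal = p at hp1
    have hp : 0 < p := by linarith
    have e : ∀ ξ : ℝ, ‖Real.exp (-(s/2) * ξ^2)‖ₑ ^ p =
        ENNReal.ofReal (Real.exp (-(p * s/2) * ξ^2)) := by
      intro ξ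
      rw [Real.enorm_of_nonneg (Real.exp_pos _).le,
        ENNReal.ofReal_rpow_of_nonneg (Real.exp_pos _).le hp.le, ← Real.exp_mul]
      congr 2
      ring
    simp_rw [e]
    rw [← ofReal_integral_eq_lintegral_ofReal (integrable_exp_neg_mul_sq (by positivity))
      (Filter.Eventually.of_forall fun ξ => (Real.exp_pos _).le), integral_gaussian,
      ENNReal.ofReal_rpow_of_nonneg (Real.sqrt_nonneg _) (by positivity)]
    apply ENNReal.ofReal_le_ofReal
    have h1 : Real.sqrt (Real.pi / (p * s / 2)) ≤ Real.sqrt (2 * Real.pi) * s ^ (-1/2 : ℝ) := by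
      have h2 : s ^ (-1/2 : ℝ) = Real.sqrt (s⁻¹) := by
        rw [Real.sqrt_eq_rpow, Real.inv_rpow hs.le, ← Real.rpow_neg hs.le]
        norm_num
      rw [h2, ← Real.sqrt_mul (by positivity)]
      apply Real.sqrt_le_sqrt
      rw [div_le_iff₀ (by positivity)]
      have : 2 * Real.pi * s⁻¹ * (p * s / 2) = Real.pi * p := by
        field_simp
      rw [this]
      nlinarith [Real.pi_pos]
    calc Real.sqrt (Real.pi / (p * s / 2)) ^ (1/p)
        ≤ (Real.sqrt (2 * Real.pi) * s ^ (-1/2 : ℝ)) ^ (1/p) :=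
          Real.rpow_le_rpow (Real.sqrt_nonneg _) h1 (by positivity)
      _ = Real.sqrt (2 * Real.pi) ^ (1/p) * s ^ (-p⁻¹/2) := by
          rw [Real.mul_rpow (Real.sqrt_nonneg _) (by positivity), ← Real.rpow_mul hs.le]
          congr 2
          ring
      _ ≤ _ := by
          apply mul_le_mul_of_nonneg_right _ (by positivity)
          calc Real.sqrt (2 * Real.pi) ^ (1/p) ≤ Real.sqrt (2 * Real.pi) ^ (1 : ℝ) :=
                Real.rpow_le_rpow_of_exponent_le one_le_sqrt_two_pi
                  ((div_le_one hp).mpr hp1)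
            _ = _ := Real.rpow_one _

/-- For every `α ≥ 0` there is `C > 0` such that for all `t ≥ 0` and all
`q ∈ [1,∞]`, the `L^q` norm over `{|ξ| < 1/2}` of `ξ ↦ |ξ|^α·K̂₀(t,ξ)` is at most
`C·(1+t)^(-(1/q + α)/2)` (with `1/∞ = 0`). -/
theorem K0_low_Lq_decay (α : ℝ) (hα : 0 ≤ α) :
    ∃ C : ℝ, 0 < C ∧ ∀ t : ℝ, 0 ≤ t → ∀ q : ℝ≥0∞, 1 ≤ q →
      eLpNorm (fun ξ : ℝ => |ξ| ^ α * K0low t ξ) q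
          (volume.restrict {ξ : ℝ | |ξ| < 1/2}) ≤
        ENNReal.ofReal (C * (1 + t) ^ (-(q⁻¹.toReal + α) / 2)) := by
  refine ⟨Real.exp (1/4) * Real.exp (α^2/2) * Real.sqrt (2 * Real.pi), by positivity, ?_⟩
  intro t ht q hq
  have hs : 0 < 1 + t := by linarith
  set D : ℝ := Real.exp (1/4) * Real.exp (α^2/2) * (1 + t) ^ (-α/2) with hD
  have hD0 : 0 ≤ D := by positivity
  have hmeas : MeasurableSet {ξ : ℝ | |ξ| < 1/2} :=
    measurableSet_lt continuous_abs.measurable measurable_const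
  calc eLpNorm (fun ξ : ℝ => |ξ| ^ α * K0low t ξ) q (volume.restrict {ξ : ℝ | |ξ| < 1/2})
      ≤ eLpNorm (D • fun ξ : ℝ => Real.exp (-((1 + t)/2) * ξ^2)) q
          (volume.restrict {ξ : ℝ | |ξ| < 1/2}) := by
        apply eLpNorm_mono_ae_real
        filter_upwards [ae_restrict_mem hmeas] with ξ hξ
        rw [Real.norm_of_nonneg (mul_nonneg (by positivity) (K0low_nonneg _ _))]
        exact pointwise_bound α hα t ξ ht hξ
    _ ≤ eLpNorm (D • fun ξ : ℝ => Real.exp (-((1 + t)/2) * ξ^2)) q volume :=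
        eLpNorm_mono_measure _ Measure.restrict_le_self
    _ = ENNReal.ofReal D * eLpNorm (fun ξ : ℝ => Real.exp (-((1 + t)/2) * ξ^2)) q volume := by
        rw [eLpNorm_const_smul, Real.enorm_of_nonneg hD0]
    _ ≤ ENNReal.ofReal D *
          ENNReal.ofReal (Real.sqrt (2 * Real.pi) * (1 + t) ^ (-q⁻¹.toReal/2)) := by
        gcongr
        exact gauss_eLpNorm (1 + t) hs q hq
    _ = _ := by
        rw [← ENNReal.ofReal_mul hD0, hD,
          show -(q⁻¹.toReal + α) / 2 = -α/2 + -q⁻¹.toReal/2 by ring, Real.rpow_add hs]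
        congr 1
        ring

end
end

section
/- For every α ≥ 0 there exists a constant C > 0 (depending only on α) such that for all t ≥ 0 and all q ∈ [1,∞], the L^q norm over the set {ξ ∈ ℝ : |ξ| < 1/2} of the function ξ ↦ |ξ|^α·K̂₁(t,ξ) is at most C·(1+t)^{−(1/q + α)/2} (with the convention 1/∞ = 0, the case q = ∞ being the essential supremum). -/
open MeasureTheory
open scoped ENNReal

noncomputable section

lemma K1low_bound (t ξ : ℝ) (ht : 0 ≤ t) (hξ : |ξ| < 1/2) :
    |K1low t ξ| ≤ 8 * Real.exp (-(ξ^2 * t / 2)) := by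
  have hx : ξ^2 < 1/4 := by
    have := abs_lt.1 hξ
    nlinarith [this.1, this.2]
  unfold K1low
  set b := Real.sqrt (1/4 - ξ^2) with hb
  have hb0 : 0 < b := Real.sqrt_pos.2 (by linarith)
  have hb2 : b^2 = 1/4 - ξ^2 := Real.sq_sqrt (by linarith)
  have hx0 : 0 ≤ ξ^2 := sq_nonneg ξ
  have hbx : b ≤ 1/2 - ξ^2 := by
    apply le_of_sq_le_sq _ (by linarith)
    rw [hb2]; nlinarith
  have hle : Real.exp ((-1/2 - b) * t) ≤ Real.exp ((-1/2 + b) * t) := by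
    apply Real.exp_le_exp.2
    nlinarith
  have hnn : 0 ≤ (Real.exp ((-1/2 + b) * t) - Real.exp ((-1/2 - b) * t)) / (2 * b) :=
    div_nonneg (by linarith) (by linarith)
  rw [abs_of_nonneg hnn, div_le_iff₀ (by linarith)]
  rcases le_or_gt (1/4) b with h | h
  · have h1 : Real.exp ((-1/2 + b) * t) ≤ Real.exp (-(ξ^2 * t / 2)) := by
      apply Real.exp_le_exp.2
      nlinarith [mul_nonneg hx0 ht]
    have := Real.exp_pos ((-1/2 - b) * t)
    have := Real.exp_pos (-(ξ^2 * t / 2))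
    nlinarith
  · have h1 : Real.exp ((-1/2 - b) * t) = Real.exp ((-1/2 + b) * t) * Real.exp (-(2 * b * t)) := by
      rw [← Real.exp_add]; congr 1; ring
    have h2 := Real.add_one_le_exp (-(2 * b * t))
    have h3 : Real.exp ((-1/2 + b) * t) ≤ Real.exp (-(ξ^2 * t / 2)) * Real.exp (-(t/8)) := by
      rw [← Real.exp_add]
      apply Real.exp_le_exp.2
      nlinarith
    have h4 : t * Real.exp (-(t/8)) ≤ 8 := by
      have := Real.add_one_le_exp (t/8)
      rw [Real.exp_neg, ← div_eq_mul_inv, div_le_iff₀ (Real.exp_pos _)]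
      linarith
    have hE := Real.exp_pos ((-1/2 + b) * t)
    have hG := Real.exp_pos (-(ξ^2 * t / 2))
    rw [h1]
    calc Real.exp ((-1/2 + b) * t) - Real.exp ((-1/2 + b) * t) * Real.exp (-(2 * b * t))
        ≤ Real.exp ((-1/2 + b) * t) * (2 * b * t) := by nlinarith
      _ ≤ (Real.exp (-(ξ^2 * t / 2)) * Real.exp (-(t/8))) * (2 * b * t) := by gcongr
      _ = Real.exp (-(ξ^2 * t / 2)) * (2 * b) * (t * Real.exp (-(t/8))) := by ring
      _ ≤ Real.exp (-(ξ^2 * t / 2)) * (2 * b) * 8 := by gcongr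
      _ = _ := by ring

lemma K1low_pt (α : ℝ) (hα : 0 ≤ α) (t ξ : ℝ) (ht : 0 ≤ t) (hξ : |ξ| < 1/2) :
    ‖|ξ| ^ α * K1low t ξ‖ ≤ (16 * (4 * (α/2 + 1)) ^ (α/2) * (1 + t) ^ (-(α/2))) *
      ‖Real.exp (-((1 + t)/4) * ξ^2)‖ := by
  have hx : ξ^2 < 1/4 := by
    have := abs_lt.1 hξ
    nlinarith [this.1, this.2]
  have hs : 0 < 1 + t := by linarith
  obtain ⟨β, rfl⟩ : ∃ β, α = 2 * β := ⟨α/2, by ring⟩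
  have hβ : 0 ≤ β := by linarith
  rw [show 2 * β / 2 = β by ring]
  set k := 4 * (β + 1) with hk
  have hk0 : 0 < k := by linarith
  have h1 : |ξ| ^ (2 * β) = (1 + t) ^ (-β) * ((1 + t) * ξ^2) ^ β := by
    rw [Real.rpow_mul (abs_nonneg _), Real.mul_rpow hs.le (sq_nonneg _), ← mul_assoc,
      ← Real.rpow_add hs]
    simp
  set u := (1 + t) * ξ^2 with hu
  have hu0 : 0 ≤ u := by positivity
  have h2 : u ^ β ≤ k ^ β * Real.exp (u / 4) := by
    have : u ≤ k * Real.exp (u / k) := by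
      have := Real.add_one_le_exp (u / k)
      have hku : u = k * (u / k) := by field_simp
      calc u = k * (u / k) := hku
        _ ≤ _ := by gcongr; linarith
    calc u ^ β ≤ (k * Real.exp (u / k)) ^ β := by gcongr
      _ = k ^ β * Real.exp (u / k * β) := by
        rw [Real.mul_rpow hk0.le (Real.exp_pos _).le, ← Real.exp_mul]
      _ ≤ _ := by
        gcongr
        rw [div_mul_eq_mul_div, div_le_div_iff₀ hk0 (by norm_num)]
        nlinarith
  have h3 : |K1low t ξ| ≤ 16 * Real.exp (-(u/2)) := by
    refine (K1low_bound t ξ ht hξ).trans ?_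
    have : Real.exp (-(ξ^2 * t / 2)) = Real.exp (ξ^2/2) * Real.exp (-(u/2)) := by
      rw [← Real.exp_add, hu]; congr 1; ring
    have h5 : Real.exp (ξ^2/2) ≤ 2 := by
      have h6 := Real.add_one_le_exp (-(ξ^2/2))
      rw [Real.exp_neg] at h6
      have h7 : 1/2 ≤ (Real.exp (ξ^2/2))⁻¹ := by linarith
      rw [le_inv_comm₀ (by norm_num) (Real.exp_pos _)] at h7
      simpa using h7
    rw [this]
    nlinarith [Real.exp_pos (-(u/2))]
  have h0 : 0 ≤ |ξ| ^ (2 * β) := by positivity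
  rw [norm_mul, Real.norm_eq_abs, Real.norm_eq_abs, Real.norm_eq_abs, abs_of_nonneg h0,
    abs_of_pos (Real.exp_pos _), h1]
  calc (1 + t) ^ (-β) * u ^ β * |K1low t ξ|
      ≤ (1 + t) ^ (-β) * (k ^ β * Real.exp (u / 4)) * (16 * Real.exp (-(u/2))) := by gcongr
    _ = 16 * k ^ β * (1 + t) ^ (-β) * (Real.exp (u / 4) * Real.exp (-(u/2))) := by ring
    _ = _ := by
      rw [← Real.exp_add, hu]; congr 2; ring

lemma gauss_Lq (s : ℝ) (hs : 0 < s) (q : ℝ≥0∞) (hq : 1 ≤ q) (S : Set ℝ) :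
    eLpNorm (fun ξ : ℝ => Real.exp (-(s/4) * ξ^2)) q (volume.restrict S) ≤
      ENNReal.ofReal (4 * s ^ (-(q⁻¹.toReal / 2))) := by
  have hle : ∀ ξ : ℝ, Real.exp (-(s/4) * ξ^2) ≤ 1 := fun ξ => by
    apply Real.exp_le_one_iff.2
    nlinarith [sq_nonneg ξ]
  refine (eLpNorm_mono_measure _ Measure.restrict_le_self).trans ?_
  rcases eq_or_ne q ⊤ with rfl | hqt
  · rw [eLpNorm_exponent_top]
    refine (eLpNormEssSup_le_of_ae_bound (C := 1) (Filter.Eventually.of_forall fun ξ => ?_)).trans ?_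
    · rw [Real.norm_eq_abs, abs_of_pos (Real.exp_pos _)]; exact hle ξ
    · apply ENNReal.ofReal_le_ofReal; simp
  have hq0 : q ≠ 0 := (lt_of_lt_of_le one_pos hq).ne'
  have hr : 1 ≤ q.toReal := by
    rw [← ENNReal.toReal_one]; exact ENNReal.toReal_mono hqt hq
  rw [eLpNorm_eq_lintegral_rpow_enorm_toReal hq0 hqt, ENNReal.toReal_inv]
  set r := q.toReal
  have hI : ∫⁻ ξ : ℝ, ‖Real.exp (-(s/4) * ξ^2)‖ₑ ^ r ≤
      ENNReal.ofReal (Real.sqrt (Real.pi / (s/4))) := by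
    rw [← integral_gaussian, ofReal_integral_eq_lintegral_ofReal
      (integrable_exp_neg_mul_sq (by linarith)) (Filter.Eventually.of_forall fun ξ => (Real.exp_pos _).le)]
    refine lintegral_mono fun ξ => ?_
    rw [Real.enorm_eq_ofReal (Real.exp_pos _).le]
    calc _ ≤ (ENNReal.ofReal (Real.exp (-(s/4) * ξ^2))) ^ (1:ℝ) := by
          apply ENNReal.rpow_le_rpow_of_exponent_ge _ hr
          rw [← ENNReal.ofReal_one]; exact ENNReal.ofReal_le_ofReal (hle ξ)
      _ = _ := ENNReal.rpow_one _
  refine (ENNReal.rpow_le_rpow hI (by positivity)).trans ?_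
  rw [ENNReal.ofReal_rpow_of_nonneg (Real.sqrt_nonneg _) (by positivity)]
  apply ENNReal.ofReal_le_ofReal
  have e : Real.sqrt (Real.pi / (s/4)) ≤ 4 * s ^ (-(1/2) : ℝ) := by
    rw [show Real.pi / (s/4) = (4 * Real.pi) * s⁻¹ by field_simp, Real.sqrt_mul (by positivity),
      Real.sqrt_inv, Real.rpow_neg hs.le, ← Real.sqrt_eq_rpow]
    gcongr
    apply Real.sqrt_le_iff.2
    constructor <;> linarith [Real.pi_le_four]
  calc _ ≤ (4 * s ^ (-(1/2) : ℝ)) ^ (1/r) := by gcongr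
    _ = 4 ^ (1/r) * s ^ (-(r⁻¹/2)) := by
      rw [Real.mul_rpow (by norm_num) (by positivity), ← Real.rpow_mul hs.le]
      congr 2; field_simp
    _ ≤ 4 ^ (1:ℝ) * s ^ (-(r⁻¹/2)) := by
      gcongr
      · norm_num
      · rw [div_le_one (by linarith)]; exact hr
    _ = _ := by simp

/-- For every `α ≥ 0` there is `C > 0` such that for all `t ≥ 0` and all
`q ∈ [1,∞]`, the `L^q` norm over `{|ξ| < 1/2}` of `ξ ↦ |ξ|^α·K̂₁(t,ξ)` is at most
`C·(1+t)^(-(1/q + α)/2)` (with `1/∞ = 0`). -/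
theorem K1_low_Lq_decay (α : ℝ) (hα : 0 ≤ α) :
    ∃ C : ℝ, 0 < C ∧ ∀ t : ℝ, 0 ≤ t → ∀ q : ℝ≥0∞, 1 ≤ q →
      eLpNorm (fun ξ : ℝ => |ξ| ^ α * K1low t ξ) q
          (volume.restrict {ξ : ℝ | |ξ| < 1/2}) ≤
        ENNReal.ofReal (C * (1 + t) ^ (-(q⁻¹.toReal + α) / 2)) := by
  refine ⟨16 * (4 * (α/2 + 1)) ^ (α/2) * 4, by positivity, fun t ht q hq => ?_⟩
  have hs : 0 < 1 + t := by linarith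
  have hS : MeasurableSet {ξ : ℝ | |ξ| < 1/2} :=
    measurableSet_lt measurable_id.abs measurable_const
  refine (eLpNorm_le_mul_eLpNorm_of_ae_le_mul
    ((ae_restrict_iff' hS).2 (Filter.Eventually.of_forall
      fun ξ hξ => K1low_pt α hα t ξ ht hξ)) q).trans ?_
  refine (mul_le_mul_right (gauss_Lq (1 + t) hs q hq _) _).trans ?_
  rw [← ENNReal.ofReal_mul (by positivity)]
  apply ENNReal.ofReal_le_ofReal
  apply le_of_eq
  rw [show -(q⁻¹.toReal + α) / 2 = -(α/2) + -(q⁻¹.toReal/2) by ring, Real.rpow_add hs]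
  ring

end
end

section
/- There exists a constant C > 0 such that for all t ≥ 0, all q ∈ [1,∞], and for i = 0, 1, the L^q norm over the set {ξ ∈ ℝ : |ξ| < 1/2} of the function ξ ↦ ∂ₜK̂ᵢ(t,ξ) is at most C·(1+t)^{−1 − 1/(2q)} (with the convention 1/∞ = 0, the case q = ∞ being the essential supremum), where ∂ₜ denotes the derivative with respect to t at fixed ξ. -/
open MeasureTheory
open scoped ENNReal

noncomputable section

/-- Elementary bound for the parabolic part. -/
lemma aux_P (t x : ℝ) (ht : 0 ≤ t) (hx : |x| < 1/2) :
    x^2 * Real.exp (-(x^2 * t)) ≤ 2 * ((1+t)⁻¹ * Real.exp (-((1+t)/2) * x^2)) := by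
  have hx2 : x^2 ≤ 1/4 := by
    have := abs_lt.1 hx
    nlinarith
  have hs : 0 < 1 + t := by linarith
  have h1 : (1+t) * x^2 ≤ Real.exp ((1+t)*x^2/2) := by
    have h := Real.add_one_le_exp ((1+t)*x^2/4)
    have h0 : 0 ≤ (1+t)*x^2/4 := by positivity
    have : Real.exp ((1+t)*x^2/2) = Real.exp ((1+t)*x^2/4) * Real.exp ((1+t)*x^2/4) := by
      rw [← Real.exp_add]; ring_nf
    rw [this]
    nlinarith [sq_nonneg ((1+t)*x^2/4 - 1)]
  have h2 : Real.exp (x^2) ≤ 2 := by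
    have : Real.exp (x^2) ≤ Real.exp (1/4) := Real.exp_le_exp.2 hx2
    have h4 : Real.exp (1/4) * Real.exp (-1/4) = 1 := by
      rw [← Real.exp_add]; norm_num
    have h5 := Real.add_one_le_exp (-1/4 : ℝ)
    nlinarith [Real.exp_pos (1/4 : ℝ)]
  have e1 : Real.exp (-(x^2*t)) = Real.exp (x^2) * (Real.exp (-((1+t)/2)*x^2) * Real.exp (-((1+t)*x^2/2))) := by
    rw [← Real.exp_add, ← Real.exp_add]; ring_nf
  have e2 : Real.exp ((1+t)*x^2/2) * Real.exp (-((1+t)*x^2/2)) = 1 := by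
    rw [← Real.exp_add]; simp
  have h3 : (1+t) * x^2 * Real.exp (-((1+t)*x^2/2)) ≤ 1 := by
    refine le_trans ?_ e2.le
    gcongr
  rw [e1]
  have h6 : x^2 * Real.exp (-((1+t)*x^2/2)) ≤ (1+t)⁻¹ := by
    rw [← one_div, le_div_iff₀ hs]; linarith
  calc _ = Real.exp (x^2) * ((x^2 * Real.exp (-((1+t)*x^2/2))) * Real.exp (-((1+t)/2)*x^2)) := by ring
    _ ≤ _ := by gcongr

/-- Elementary bound for the exponentially decaying part. -/
lemma aux_Q (t x : ℝ) (ht : 0 ≤ t) (hx : |x| < 1/2) :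
    (1+t) * Real.exp (-(t/4)) ≤ 512 * ((1+t)⁻¹ * Real.exp (-((1+t)/2) * x^2)) := by
  have hx2 : x^2 ≤ 1/4 := by
    have := abs_lt.1 hx
    nlinarith
  have hs : 0 < 1 + t := by linarith
  have h2 : Real.exp (1/4) ≤ 2 := by
    have h4 : Real.exp (1/4) * Real.exp (-1/4) = 1 := by
      rw [← Real.exp_add]; norm_num
    have h5 := Real.add_one_le_exp (-1/4 : ℝ)
    nlinarith [Real.exp_pos (1/4 : ℝ)]
  have h1 : (1+t)^2 ≤ 256 * Real.exp ((1+t)/8) := by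
    have h := Real.add_one_le_exp ((1+t)/16)
    have : Real.exp ((1+t)/8) = Real.exp ((1+t)/16) * Real.exp ((1+t)/16) := by
      rw [← Real.exp_add]; ring_nf
    rw [this]
    nlinarith
  have h3 : Real.exp (-((1+t)/8)) ≤ Real.exp (-((1+t)/2) * x^2) := by
    apply Real.exp_le_exp.2; nlinarith
  have e1 : Real.exp (-(t/4)) = Real.exp (1/4) * (Real.exp (-((1+t)/8)) * Real.exp (-((1+t)/8))) := by
    rw [← Real.exp_add, ← Real.exp_add]; ring_nf
  have e2 : Real.exp ((1+t)/8) * Real.exp (-((1+t)/8)) = 1 := by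
    rw [← Real.exp_add]; simp
  have h5 : (1+t)^2 * Real.exp (-((1+t)/8)) ≤ 256 := by
    calc _ ≤ 256 * Real.exp ((1+t)/8) * Real.exp (-((1+t)/8)) := by gcongr
      _ = 256 := by rw [mul_assoc, e2]; norm_num
  have e3 : (1+t) = (1+t)⁻¹ * (1+t)^2 := by field_simp
  rw [e1]
  calc (1+t) * (Real.exp (1/4) * (Real.exp (-((1+t)/8)) * Real.exp (-((1+t)/8))))
      = (1+t)⁻¹ * (1+t)^2 * (Real.exp (1/4) * (Real.exp (-((1+t)/8)) * Real.exp (-((1+t)/8)))) := by rw [← e3]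
    _ = Real.exp (1/4) * ((1+t)⁻¹ * (((1+t)^2 * Real.exp (-((1+t)/8))) * Real.exp (-((1+t)/8)))) := by ring
    _ ≤ 2 * ((1+t)⁻¹ * (256 * Real.exp (-((1+t)/2) * x^2))) := by gcongr
    _ = _ := by ring

lemma hasDeriv_exp_lin (a t : ℝ) :
    HasDerivAt (fun s : ℝ => Real.exp (a * s)) (a * Real.exp (a * t)) t := by
  have h : HasDerivAt (fun s : ℝ => a * s) a t := by
    simpa using (hasDerivAt_id t).const_mul a
  simpa [mul_comm] using h.exp

/-- Facts on the square root. -/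
lemma aux_b (x : ℝ) (hx : |x| < 1/2) :
    0 < Real.sqrt (1/4 - x^2) ∧ Real.sqrt (1/4 - x^2) ≤ 1/2 ∧
    x^2 ≤ 1/2 - Real.sqrt (1/4 - x^2) ∧ 1/2 - Real.sqrt (1/4 - x^2) ≤ 2 * x^2 := by
  have hx2 : x^2 < 1/4 := by
    have := abs_lt.1 hx
    nlinarith
  have hp : 0 < Real.sqrt (1/4 - x^2) := Real.sqrt_pos.2 (by linarith)
  have hsq : Real.sqrt (1/4 - x^2) ^ 2 = 1/4 - x^2 := Real.sq_sqrt (by linarith)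
  have hle : Real.sqrt (1/4 - x^2) ≤ 1/2 := by nlinarith [sq_nonneg x]
  exact ⟨hp, hle, by nlinarith, by nlinarith⟩

lemma aux_minus (t x b : ℝ) (ht : 0 ≤ t) (hb : x^2 ≤ 1/2 - b) (hb' : 1/2 - b ≤ 2 * x^2) :
    0 ≤ (1/2 - b) * Real.exp ((-1/2 + b) * t) ∧
    (1/2 - b) * Real.exp ((-1/2 + b) * t) ≤ 2 * (x^2 * Real.exp (-(x^2 * t))) := by
  have h0 : 0 ≤ 1/2 - b := le_trans (sq_nonneg x) hb
  refine ⟨by positivity, ?_⟩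
  have : Real.exp ((-1/2 + b) * t) ≤ Real.exp (-(x^2*t)) := by
    apply Real.exp_le_exp.2; nlinarith
  rw [← mul_assoc]
  gcongr

lemma aux_plus (t b : ℝ) (ht : 0 ≤ t) (hb : 0 < b) (hb' : b ≤ 1/2) :
    0 ≤ (1/2 + b) * Real.exp ((-1/2 - b) * t) ∧
    (1/2 + b) * Real.exp ((-1/2 - b) * t) ≤ (1+t) * Real.exp (-(t/4)) := by
  refine ⟨by positivity, ?_⟩
  have : Real.exp ((-1/2 - b) * t) ≤ Real.exp (-(t/4)) := by
    apply Real.exp_le_exp.2; nlinarith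
  have h2 : 1/2 + b ≤ 1 + t := by linarith
  gcongr

lemma aux_K0 (t x : ℝ) (ht : 0 ≤ t) (hx : |x| < 1/2) :
    ‖deriv (fun s => K0low s x) t‖ ≤ 1100 * ((1+t)⁻¹ * Real.exp (-((1+t)/2) * x^2)) := by
  obtain ⟨hp, hle, h1, h2⟩ := aux_b x hx
  have hP := aux_P t x ht hx
  have hQ := aux_Q t x ht hx
  unfold K0low
  generalize Real.sqrt (1/4 - x^2) = b at *
  have hd := ((hasDeriv_exp_lin (-1/2 + b) t).add (hasDeriv_exp_lin (-1/2 - b) t)).const_mul (1/2)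
  have hd' := hd.deriv
  simp only [Pi.add_apply] at hd'
  have hd2 : deriv (fun s => (1/2) * (Real.exp ((-1/2 + b) * s) + Real.exp ((-1/2 - b) * s))) t = _ := hd'
  rw [hd2]
  obtain ⟨m0, m1⟩ := aux_minus t x b ht h1 h2
  obtain ⟨p0, p1⟩ := aux_plus t b ht hp hle
  rw [Real.norm_eq_abs, abs_le]
  constructor <;> linarith

lemma aux_K1 (t x : ℝ) (ht : 0 ≤ t) (hx : |x| < 1/2) :
    ‖deriv (fun s => K1low s x) t‖ ≤ 1100 * ((1+t)⁻¹ * Real.exp (-((1+t)/2) * x^2)) := by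
  obtain ⟨hp, hle, h1, h2⟩ := aux_b x hx
  have hP := aux_P t x ht hx
  have hQ := aux_Q t x ht hx
  have hG : 0 ≤ (1+t)⁻¹ * Real.exp (-((1+t)/2) * x^2) := by positivity
  unfold K1low
  generalize Real.sqrt (1/4 - x^2) = b at *
  have hd := ((hasDeriv_exp_lin (-1/2 + b) t).sub (hasDeriv_exp_lin (-1/2 - b) t)).div_const (2*b)
  have hd' := hd.deriv
  have hd2 : deriv (fun s => (Real.exp ((-1/2 + b) * s) - Real.exp ((-1/2 - b) * s)) / (2*b)) t = _ := hd'
  rw [hd2]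
  obtain ⟨m0, m1⟩ := aux_minus t x b ht h1 h2
  obtain ⟨p0, p1⟩ := aux_plus t b ht hp hle
  generalize (1+t)⁻¹ * Real.exp (-((1+t)/2) * x^2) = G at *
  by_cases hb : 1/4 ≤ b
  · rw [Real.norm_eq_abs, abs_div, abs_of_pos (by linarith : 0 < 2*b), div_le_iff₀ (by linarith)]
    have : 550 * G ≤ 1100 * G * (2*b) := by nlinarith
    refine le_trans ?_ this
    rw [abs_le]
    constructor <;> linarith
  · push Not at hb
    have hE : Real.exp ((-1/2 + b) * t) ≤ Real.exp (-(t/4)) := by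
      apply Real.exp_le_exp.2; nlinarith
    have hF : Real.exp ((-1/2 - b) * t) ≤ Real.exp ((-1/2 + b) * t) := by
      apply Real.exp_le_exp.2; nlinarith
    have hD : Real.exp ((-1/2 + b) * t) - Real.exp ((-1/2 - b) * t)
        ≤ 2 * b * t * Real.exp ((-1/2 + b) * t) := by
      have e : Real.exp ((-1/2 - b) * t) = Real.exp ((-1/2 + b) * t) * Real.exp (-(2*b*t)) := by
        rw [← Real.exp_add]; ring_nf
      have := Real.add_one_le_exp (-(2*b*t))
      rw [e]
      nlinarith [Real.exp_pos ((-1/2 + b) * t)]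
    have hF0 := Real.exp_pos ((-1/2 - b) * t)
    generalize Real.exp ((-1/2 + b) * t) = u at *
    generalize Real.exp ((-1/2 - b) * t) = v at *
    have key : ((-1/2 + b) * u - (-1/2 - b) * v) / (2*b) = (u+v)/2 - (u-v)/(2*b)/2 := by
      field_simp; ring
    have hq : (u-v)/(2*b) ≤ t * u := by
      rw [div_le_iff₀ (by linarith)]; linarith
    have hq0 : 0 ≤ (u-v)/(2*b) := div_nonneg (by linarith) (by linarith)
    have htu : (1+t) * u ≤ (1+t) * Real.exp (-(t/4)) := by gcongr
    have htu0 : 0 ≤ t * u := mul_nonneg ht (by linarith)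
    rw [key, Real.norm_eq_abs, abs_le]
    constructor <;> nlinarith

/-- `L^q` norm of a Gaussian. -/
lemma aux_gauss (s : ℝ) (hs : 1 ≤ s) (q : ℝ≥0∞) (hq : 1 ≤ q) :
    eLpNorm (fun x : ℝ => Real.exp (-(s/2) * x^2)) q volume ≤
      ENNReal.ofReal (7 * s ^ (-(q⁻¹.toReal / 2))) := by
  have hs0 : 0 < s := by linarith
  have hle1 : ∀ x : ℝ, Real.exp (-(s/2) * x^2) ≤ 1 := by
    intro x
    apply Real.exp_le_one_iff.2
    nlinarith [sq_nonneg x, mul_nonneg hs0.le (sq_nonneg x)]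
  by_cases htop : q = ∞
  · subst htop
    rw [eLpNorm_exponent_top]
    refine le_trans (eLpNormEssSup_le_of_ae_bound (C := 1) (Filter.Eventually.of_forall ?_)) ?_
    · intro x
      rw [Real.norm_eq_abs, abs_of_pos (Real.exp_pos _)]
      exact hle1 x
    · apply ENNReal.ofReal_le_ofReal
      simp
  · have hq0 : q ≠ 0 := (lt_of_lt_of_le one_pos hq).ne'
    have hqr : 1 ≤ q.toReal := by
      have := ENNReal.toReal_mono htop hq
      simpa using this
    rw [eLpNorm_eq_lintegral_rpow_enorm_toReal hq0 htop]
    have hint : ∫⁻ x : ℝ, ‖Real.exp (-(s/2) * x^2)‖ₑ ^ q.toReal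
        ≤ ENNReal.ofReal (Real.sqrt (Real.pi / (s/2))) := by
      rw [← integral_gaussian (s/2), ofReal_integral_eq_lintegral_ofReal
        (integrable_exp_neg_mul_sq (by linarith)) (Filter.Eventually.of_forall fun x => (Real.exp_pos _).le)]
      apply lintegral_mono
      intro x
      simp only
      rw [Real.enorm_eq_ofReal (Real.exp_pos _).le]
      have h1 : ENNReal.ofReal (Real.exp (-(s/2) * x^2)) ≤ 1 := by
        simpa using hle1 x
      calc _ ≤ ENNReal.ofReal (Real.exp (-(s/2) * x^2)) ^ (1:ℝ) :=
            ENNReal.rpow_le_rpow_of_exponent_ge h1 hqr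
        _ = _ := by simp
    have hr0 : 0 ≤ 1 / q.toReal := by positivity
    refine le_trans (ENNReal.rpow_le_rpow hint hr0) ?_
    rw [ENNReal.ofReal_rpow_of_nonneg (Real.sqrt_nonneg _) hr0, ENNReal.toReal_inv]
    apply ENNReal.ofReal_le_ofReal
    have hr1 : 1 / q.toReal ≤ 1 := by
      rw [div_le_one (by linarith)]; exact hqr
    rw [← one_div]
    generalize 1 / q.toReal = r at *
    have hpi : 1 ≤ 2 * Real.pi := by linarith [Real.pi_gt_three]
    have e : Real.pi / (s/2) = (2 * Real.pi) * s⁻¹ := by field_simp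
    rw [e, Real.sqrt_eq_rpow, ← Real.rpow_mul (by positivity),
      Real.mul_rpow (by positivity) (by positivity), Real.inv_rpow hs0.le, ← Real.rpow_neg hs0.le]
    have e2 : 1/2 * r = r/2 := by ring
    rw [e2]
    have h7 : (2 * Real.pi) ^ (r/2) ≤ 7 := by
      calc (2 * Real.pi) ^ (r/2) ≤ (2 * Real.pi) ^ (1:ℝ) :=
            Real.rpow_le_rpow_of_exponent_le hpi (by linarith)
        _ = 2 * Real.pi := by simp
        _ ≤ 7 := by linarith [Real.pi_lt_d2]
    gcongr

/-- From the pointwise bound to the `L^q` bound. -/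
lemma aux_Lq (t : ℝ) (ht : 0 ≤ t) (q : ℝ≥0∞) (hq : 1 ≤ q) (f : ℝ → ℝ)
    (hf : ∀ x : ℝ, |x| < 1/2 → ‖f x‖ ≤ 1100 * ((1+t)⁻¹ * Real.exp (-((1+t)/2) * x^2))) :
    eLpNorm f q (volume.restrict {ξ : ℝ | |ξ| < 1/2}) ≤
      ENNReal.ofReal (7700 * (1 + t) ^ (-1 - q⁻¹.toReal / 2)) := by
  have hs0 : 0 < 1 + t := by linarith
  have hm : MeasurableSet {ξ : ℝ | |ξ| < 1/2} :=
    measurableSet_lt measurable_norm measurable_const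
  calc eLpNorm f q (volume.restrict {ξ : ℝ | |ξ| < 1/2})
      ≤ eLpNorm ((1100 * (1+t)⁻¹) • fun x : ℝ => Real.exp (-((1+t)/2) * x^2)) q
          (volume.restrict {ξ : ℝ | |ξ| < 1/2}) := by
        apply eLpNorm_mono_ae_real
        filter_upwards [ae_restrict_mem hm] with x hx
        have := hf x hx
        simpa [mul_assoc] using this
    _ ≤ eLpNorm ((1100 * (1+t)⁻¹) • fun x : ℝ => Real.exp (-((1+t)/2) * x^2)) q volume :=
        eLpNorm_mono_measure _ Measure.restrict_le_self
    _ = ENNReal.ofReal (1100 * (1+t)⁻¹) * eLpNorm (fun x : ℝ => Real.exp (-((1+t)/2) * x^2)) q volume := by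
        rw [eLpNorm_const_smul, Real.enorm_eq_ofReal (by positivity)]
    _ ≤ ENNReal.ofReal (1100 * (1+t)⁻¹) * ENNReal.ofReal (7 * (1+t) ^ (-(q⁻¹.toReal / 2))) := by
        gcongr
        exact aux_gauss (1+t) (by linarith) q hq
    _ = _ := by
        rw [← ENNReal.ofReal_mul (by positivity)]
        congr 1
        rw [sub_eq_add_neg, Real.rpow_add hs0, Real.rpow_neg_one]
        ring

/-- There is `C > 0` such that for all `t ≥ 0`, `q ∈ [1,∞]` and `i = 0, 1`,
the `L^q` norm over `{|ξ| < 1/2}` of `ξ ↦ ∂ₜK̂ᵢ(t,ξ)` is at most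
`C·(1+t)^(-1 - 1/(2q))` (with `1/∞ = 0`). -/
theorem kernel_time_deriv_Lq_decay :
    ∃ C : ℝ, 0 < C ∧ ∀ t : ℝ, 0 ≤ t → ∀ q : ℝ≥0∞, 1 ≤ q →
      eLpNorm (fun ξ : ℝ => deriv (fun s => K0low s ξ) t) q
          (volume.restrict {ξ : ℝ | |ξ| < 1/2}) ≤
        ENNReal.ofReal (C * (1 + t) ^ (-1 - q⁻¹.toReal / 2)) ∧
      eLpNorm (fun ξ : ℝ => deriv (fun s => K1low s ξ) t) q
          (volume.restrict {ξ : ℝ | |ξ| < 1/2}) ≤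
        ENNReal.ofReal (C * (1 + t) ^ (-1 - q⁻¹.toReal / 2)) := by
  refine ⟨7700, by norm_num, fun t ht q hq => ⟨?_, ?_⟩⟩
  · exact aux_Lq t ht q hq _ (fun x hx => aux_K0 t x ht hx)
  · exact aux_Lq t ht q hq _ (fun x hx => aux_K1 t x ht hx)

end
end

section
/- For every ε with 0 < ε < 1 there exists a constant C > 0 such that for every Schwartz function f : ℝ² → ℂ, the inequality ‖R f‖_{L¹(ℝ²)} ≤ C · ‖|∇|^{−ε} ⟨∇⟩^{2ε} f‖_{L¹(ℝ²)} holds in [0,∞] (both sides being allowed to be infinite). -/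
open MeasureTheory
open scoped ENNReal

noncomputable section

/-- One-dimensional (x-direction) Fourier multiplier operator with symbol `m`:
`(T_m f)(x,y) = (2π)⁻¹ ∫ e^{ixξ} m(ξ) (∫ e^{-iuξ} f(u,y) du) dξ`. -/
def Tmul (m : ℝ → ℂ) (f : ℝ × ℝ → ℂ) (x y : ℝ) : ℂ :=
  (2 * Real.pi : ℂ)⁻¹ *
    ∫ ξ : ℝ, Complex.exp (Complex.I * x * ξ) * m ξ *
      ∫ u : ℝ, Complex.exp (-(Complex.I * u * ξ)) * f (u, y)

/-- Fourier transform on `ℝ²`: `ĝ(ζ) = ∫ e^{-iz·ζ} g(z) dz`. -/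
def ft2 (g : ℝ × ℝ → ℂ) (ζ : ℝ × ℝ) : ℂ :=
  ∫ z : ℝ × ℝ, Complex.exp (-(Complex.I * (z.1 * ζ.1 + z.2 * ζ.2))) * g z

/-- Two-dimensional Fourier multiplier with symbol `σ`:
`(2π)⁻² ∫ e^{iz·ζ} σ(ζ) ĝ(ζ) dζ`. -/
def mult2 (σ : ℝ × ℝ → ℂ) (g : ℝ × ℝ → ℂ) (z : ℝ × ℝ) : ℂ :=
  ((2 * Real.pi : ℂ) ^ 2)⁻¹ *
    ∫ ζ : ℝ × ℝ, Complex.exp (Complex.I * (z.1 * ζ.1 + z.2 * ζ.2)) * σ ζ * ft2 g ζ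

/-- `⟨∇⟩^s`, the multiplier with symbol `(1 + |ζ|²)^{s/2}`. -/
def jap (s : ℝ) (g : ℝ × ℝ → ℂ) : ℝ × ℝ → ℂ :=
  mult2 (fun ζ => (((1 + ζ.1^2 + ζ.2^2) ^ (s/2) : ℝ) : ℂ)) g

/-- `|∇|^s`, the multiplier with symbol `|ζ|^s`. -/
def homog (s : ℝ) (g : ℝ × ℝ → ℂ) : ℝ × ℝ → ℂ :=
  mult2 (fun ζ => (((ζ.1^2 + ζ.2^2) ^ (s/2) : ℝ) : ℂ)) g

/-- Double Riesz transform `∂ₓ∂_y(−Δ)⁻¹`, the multiplier with symbol `ζ₁ζ₂/|ζ|²`. -/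
def riesz (g : ℝ × ℝ → ℂ) : ℝ × ℝ → ℂ :=
  mult2 (fun ζ => ((ζ.1 * ζ.2 / (ζ.1^2 + ζ.2^2) : ℝ) : ℂ)) g

/-- Partial derivative in the second variable. -/
def pdy (g : ℝ × ℝ → ℂ) : ℝ × ℝ → ℂ := fun p => fderiv ℝ g p (0, 1)

/-- Partial derivative in the first variable. -/
def pdx (g : ℝ × ℝ → ℂ) : ℝ × ℝ → ℂ := fun p => fderiv ℝ g p (1, 0)

lemma aux_conv {X : Type*} [MeasurableSpace X] (μ : Measure X) [SFinite μ] (H : X → ℂ)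
    (hH : Integrable H μ) (y : X → ℝ × ℝ) (hy : Measurable y) (g : ℝ × ℝ → ℂ)
    (hg : Integrable g) (z : ℝ × ℝ) :
    ∫ ζ : ℝ × ℝ, Complex.exp (Complex.I * (z.1 * ζ.1 + z.2 * ζ.2)) *
      ((∫ x, H x * Complex.exp (-(Complex.I * ((y x).1 * ζ.1 + (y x).2 * ζ.2))) ∂μ) * g ζ) =
    ∫ x, H x * (∫ ζ : ℝ × ℝ, Complex.exp (Complex.I * ((z - y x).1 * ζ.1 + (z - y x).2 * ζ.2))
      * g ζ) ∂μ := by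
  have hpint : Integrable (fun p : (ℝ × ℝ) × X =>
      Complex.exp (Complex.I * ((z - y p.2).1 * p.1.1 + (z - y p.2).2 * p.1.2)) *
        (g p.1 * H p.2)) (volume.prod μ) := by
    refine (hg.mul_prod hH).bdd_mul (c := 1) ?_ ?_
    · apply Measurable.aestronglyMeasurable
      fun_prop
    · refine Filter.Eventually.of_forall fun p => ?_
      rw [Complex.norm_exp]
      simp
  have hsw := integral_integral_swap (f := fun (ζ : ℝ × ℝ) (x : X) => 
      Complex.exp (Complex.I * ((z - y x).1 * ζ.1 + (z - y x).2 * ζ.2)) *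
        (g ζ * H x)) hpint
  trans ∫ ζ : ℝ × ℝ, ∫ x, Complex.exp (Complex.I * ((z - y x).1 * ζ.1 + (z - y x).2 * ζ.2)) *
        (g ζ * H x) ∂μ
  · congr 1 with ζ
    rw [← integral_mul_const, ← integral_const_mul]
    congr 1 with x
    have : Complex.exp (Complex.I * ((z - y x).1 * ζ.1 + (z - y x).2 * ζ.2)) =
      Complex.exp (Complex.I * (z.1 * ζ.1 + z.2 * ζ.2)) *
      Complex.exp (-(Complex.I * ((y x).1 * ζ.1 + (y x).2 * ζ.2))) := by
      rw [← Complex.exp_add]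
      congr 1
      simp only [Prod.fst_sub, Prod.snd_sub]
      push_cast
      ring
    rw [this]
    ring
  · rw [hsw]
    congr 1 with x
    rw [← integral_const_mul]
    congr 1 with ζ
    ring

lemma aux_L1 {X : Type*} [MeasurableSpace X] (μ : Measure X) [SFinite μ] (H : X → ℂ)
    (hH : Integrable H μ) (y : X → ℝ × ℝ) (hy : Measurable y) (g : ℝ × ℝ → ℂ)
    (hg : Integrable g) :
    ∫⁻ z : ℝ × ℝ, ‖∫ ζ : ℝ × ℝ, Complex.exp (Complex.I * (z.1 * ζ.1 + z.2 * ζ.2)) *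
      ((∫ x, H x * Complex.exp (-(Complex.I * ((y x).1 * ζ.1 + (y x).2 * ζ.2))) ∂μ) * g ζ)‖ₑ
    ≤ (∫⁻ x, ‖H x‖ₑ ∂μ) * ∫⁻ z : ℝ × ℝ, ‖∫ ζ : ℝ × ℝ,
      Complex.exp (Complex.I * (z.1 * ζ.1 + z.2 * ζ.2)) * g ζ‖ₑ := by
  simp_rw [aux_conv μ H hH y hy g hg]
  set F : ℝ × ℝ → ℂ := fun z => ∫ ζ : ℝ × ℝ,
      Complex.exp (Complex.I * (z.1 * ζ.1 + z.2 * ζ.2)) * g ζ with hF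
  have hFc : Continuous F := by
    refine continuous_of_dominated (bound := fun ζ => ‖g ζ‖) ?_ ?_ hg.norm ?_
    · intro z
      refine AEStronglyMeasurable.mul ?_ hg.aestronglyMeasurable
      apply Continuous.aestronglyMeasurable
      fun_prop
    · intro z
      refine Filter.Eventually.of_forall fun p => ?_
      rw [norm_mul, Complex.norm_exp]
      simp
    · refine Filter.Eventually.of_forall fun p => ?_
      fun_prop
  have hFm : Measurable F := hFc.measurable
  change ∫⁻ z : ℝ × ℝ, ‖∫ x, H x * F (z - y x) ∂μ‖ₑ ≤ _ * ∫⁻ z, ‖F z‖ₑ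
  calc ∫⁻ z : ℝ × ℝ, ‖∫ x, H x * F (z - y x) ∂μ‖ₑ 
      ≤ ∫⁻ z : ℝ × ℝ, ∫⁻ x, ‖H x‖ₑ * ‖F (z - y x)‖ₑ ∂μ := by
        refine lintegral_mono fun z => ?_
        refine (enorm_integral_le_lintegral_enorm _).trans_eq ?_
        simp_rw [enorm_mul]
    _ = ∫⁻ x, (∫⁻ z : ℝ × ℝ, ‖H x‖ₑ * ‖F (z - y x)‖ₑ) ∂μ := by
        refine lintegral_lintegral_swap ?_
        have h1 : AEMeasurable (fun p : (ℝ × ℝ) × X => ‖H p.2‖ₑ) (volume.prod μ) :=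
          hH.aestronglyMeasurable.comp_snd.enorm
        have h2 : Measurable (fun p : (ℝ × ℝ) × X => ‖F (p.1 - y p.2)‖ₑ) := by fun_prop
        exact h1.mul h2.aemeasurable
    _ = ∫⁻ x, ‖H x‖ₑ * (∫⁻ z : ℝ × ℝ, ‖F z‖ₑ) ∂μ := by
        congr 1 with x
        rw [lintegral_const_mul]
        · rw [lintegral_sub_right_eq_self (fun z => ‖F z‖ₑ)]
        · fun_prop
    _ = _ := by
        rw [lintegral_mul_const'']
        exact hH.aestronglyMeasurable.enorm

lemma aux_gauss_s18 (t : ℝ) : ∫ x : ℝ, ((x * Real.exp (-(1/4) * x ^ 2) : ℝ) : ℂ) *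
    Complex.exp (-(Complex.I * (x * t))) =
    -4 * Complex.I * (Real.sqrt Real.pi) * t * Complex.exp (-(t:ℂ) ^ 2) := by
  have e1 : ∀ x : ℝ, Complex.exp (-(1/4) * (x:ℂ)^2 + (-(Complex.I * t)) * x + 0)  =
      Complex.exp (-(Complex.I * (x * t))) * ((Real.exp (-(1/4) * x ^ 2) : ℝ) : ℂ) := by
    intro x
    push_cast
    rw [← Complex.exp_add]
    congr 1
    ring
  have hI : Integrable (fun x : ℝ => Complex.exp (-(Complex.I * (x * t))) *
      ((Real.exp (-(1/4) * x ^ 2) : ℝ) : ℂ)) := by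
    simp_rw [← e1]
    exact integrable_cexp_quadratic (by norm_num) _ _
  have hv : ∫ x : ℝ, Complex.exp (-(Complex.I * (x * t))) * ((Real.exp (-(1/4) * x ^ 2) : ℝ) : ℂ) =
      2 * (Real.sqrt Real.pi) * Complex.exp (-(t:ℂ) ^ 2) := by
    simp_rw [← e1]
    rw [integral_cexp_quadratic (by norm_num)]
    congr 1
    · have : (Real.pi : ℂ) / -(-(1/4)) = ((4 * Real.pi : ℝ) : ℂ) := by push_cast; ring
      rw [this]
      have h2 : (1/2 : ℂ) = ((1/2 : ℝ) : ℂ) := by push_cast; ring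
      rw [h2, ← Complex.ofReal_cpow (by positivity), ← Real.sqrt_eq_rpow, Real.sqrt_mul (by norm_num),
        show (4:ℝ) = 2 ^ 2 by norm_num, Real.sqrt_sq (by norm_num)]
      push_cast; ring
    · congr 1
      ring_nf
      simp
  have hI2 : Integrable (fun x : ℝ => Complex.exp (-(Complex.I * (x * t))) *
      ((x * Real.exp (-(1/4) * x ^ 2) : ℝ) : ℂ)) := by
    refine (Integrable.ofReal (integrable_mul_exp_neg_mul_sq (b := 1/4) (by norm_num))).bdd_mul (c := 1) ?_ ?_
    · apply Continuous.aestronglyMeasurable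
      fun_prop
    · refine Filter.Eventually.of_forall fun p => ?_
      rw [Complex.norm_exp]
      simp
  have key := integral_mul_deriv_eq_deriv_mul_of_integrable
    (u := fun x : ℝ => Complex.exp (-(Complex.I * (x * t))))
    (u' := fun x : ℝ => (-(Complex.I * t)) * Complex.exp (-(Complex.I * (x * t))))
    (v := fun x : ℝ => ((Real.exp (-(1/4) * x ^ 2) : ℝ) : ℂ))
    (v' := fun x : ℝ => (-1/2 : ℂ) * ((x * Real.exp (-(1/4) * x ^ 2) : ℝ) : ℂ)) ?_ ?_ ?_ ?_ ?_
  · have e2 : ∀ x : ℝ, Complex.exp (-(Complex.I * (x * t))) * ((-1/2 : ℂ) * ((x * Real.exp (-(1/4) * x ^ 2) : ℝ) : ℂ)) = (-1/2) * (((x * Real.exp (-(1/4) * x ^ 2) : ℝ) : ℂ) *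
      Complex.exp (-(Complex.I * (x * t)))) := fun x => by ring
    simp_rw [e2, mul_assoc, integral_const_mul, hv] at key
    have : ∀ a b : ℂ, (-1/2) * a = b → a = -2 * b := by
      intro a b h; rw [← h]; ring
    rw [this _ _ key]
    ring
  · intro x _
    have h := (((hasDerivAt_id (x:ℂ)).mul_const (t:ℂ)).const_mul Complex.I).neg.cexp.comp_ofReal
    refine HasDerivAt.congr_deriv (f := fun x : ℝ => Complex.exp (-(Complex.I * (x * t)))) h ?_
    simp
    ring
  · intro x _
    have h := (((hasDerivAt_id x).pow 2).const_mul (-(1/4):ℝ)).exp.ofReal_comp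
    refine HasDerivAt.congr_deriv (f := fun x : ℝ => ((Real.exp (-(1/4) * x ^ 2) : ℝ) : ℂ)) h ?_
    simp
    ring
  · convert hI2.const_mul (-1/2) using 1
    ext x
    simp only [Pi.mul_apply]
    ring
  · convert hI.const_mul (-(Complex.I * t)) using 1
    ext x
    simp only [Pi.mul_apply]
    ring
  · exact hI

def kerA (ε s : ℝ) : ℝ := Real.exp (-s) * s ^ (ε / 2 - 1)
def kerB (ε v : ℝ) : ℝ := v ^ (-(ε / 2)) / (1 + v)
def kerk (a : ℝ) : ℝ := a * Real.exp (-(1/4) * a ^ 2)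

lemma kerA_int (ε : ℝ) (hε : 0 < ε) : Integrable (kerA ε) (volume.restrict (Set.Ioi 0)) :=
  Real.GammaIntegral_convergent (s := ε / 2) (by positivity)

lemma kerB_int (ε : ℝ) (hε : 0 < ε) (hε' : ε < 1) :
    Integrable (kerB ε) (volume.restrict (Set.Ioi 0)) := by
  have hm : Measurable (kerB ε) := by unfold kerB; fun_prop
  have h1 : IntegrableOn (kerB ε) (Set.Ioo 0 1) := by
    have := (intervalIntegral.integrableOn_Ioo_rpow_iff (s := -(ε/2)) (t := 1) one_pos).2 (by linarith)
    refine Integrable.mono' this hm.aestronglyMeasurable ?_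
    refine (ae_restrict_iff' measurableSet_Ioo).2 (Filter.Eventually.of_forall fun v hv => ?_)
    have h0 : 0 < v := hv.1
    have : 0 ≤ kerB ε v := by unfold kerB; positivity
    rw [Real.norm_of_nonneg this]
    exact div_le_self (by positivity) (by linarith)
  have h2 : IntegrableOn (kerB ε) (Set.Ioi (1/2)) := by
    have := integrableOn_Ioi_rpow_of_lt (a := -(ε/2) - 1) (c := 1/2) (by linarith) (by norm_num)
    refine Integrable.mono' this hm.aestronglyMeasurable ?_
    refine (ae_restrict_iff' measurableSet_Ioi).2 (Filter.Eventually.of_forall fun v hv => ?_)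
    have h0 : 0 < v := lt_trans (by norm_num) hv
    have : 0 ≤ kerB ε v := by unfold kerB; positivity
    rw [Real.norm_of_nonneg this, Real.rpow_sub_one h0.ne']
    unfold kerB
    gcongr
    linarith
  have : Set.Ioi (0:ℝ) ⊆ Set.Ioo 0 1 ∪ Set.Ioi (1/2) := by
    intro x hx
    by_cases h : x < 1
    · exact Or.inl ⟨hx, h⟩
    · right; simp only [Set.mem_Ioi]; linarith
  exact (h1.union h2).mono_set this

lemma kerk_int : Integrable kerk := integrable_mul_exp_neg_mul_sq (b := 1/4) (by norm_num)

def kerH (ε : ℝ) (p : ℝ × ℝ × ℝ × ℝ) : ℂ :=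
  (kerA ε p.1 : ℂ) * ((kerB ε p.2.1 : ℂ) * ((kerk p.2.2.1 : ℂ) * (kerk p.2.2.2 : ℂ)))

def kery (p : ℝ × ℝ × ℝ × ℝ) : ℝ × ℝ :=
  (Real.sqrt (p.1 * (1 + p.2.1)) * p.2.2.1, Real.sqrt (p.1 * (1 + p.2.1)) * p.2.2.2)

def kermu : Measure (ℝ × ℝ × ℝ × ℝ) :=
  (volume.restrict (Set.Ioi 0)).prod ((volume.restrict (Set.Ioi 0)).prod (volume.prod volume))

lemma kery_meas : Measurable kery := by unfold kery; fun_prop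

lemma kerH_int (ε : ℝ) (hε : 0 < ε) (hε' : ε < 1) : Integrable (kerH ε) kermu :=
  (kerA_int ε hε).ofReal.mul_prod ((kerB_int ε hε hε').ofReal.mul_prod
    (kerk_int.ofReal.mul_prod kerk_int.ofReal))

lemma osc_int {X : Type*} [MeasurableSpace X] {μ : Measure X} {f : X → ℂ} (hf : Integrable f μ)
    (y : X → ℝ × ℝ) (hy : Measurable y) (ζ : ℝ × ℝ) :
    Integrable (fun x => f x * Complex.exp (-(Complex.I * ((y x).1 * ζ.1 + (y x).2 * ζ.2)))) μ := by
  refine hf.mul_bdd (c := 1) ?_ ?_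
  · apply Measurable.aestronglyMeasurable
    fun_prop
  · refine Filter.Eventually.of_forall fun p => ?_
    rw [Complex.norm_exp]
    simp

lemma ker_gauss2 (t : ℝ) (ht : 0 ≤ t) (ζ : ℝ × ℝ) :
    ∫ q : ℝ × ℝ, ((kerk q.1 : ℂ) * (kerk q.2 : ℂ)) *
      Complex.exp (-(Complex.I * ((Real.sqrt t * q.1 : ℝ) * ζ.1 + (Real.sqrt t * q.2 : ℝ) * ζ.2)))
      ∂(volume.prod volume) =
    ((-16 * Real.pi * (t * (ζ.1 * ζ.2) * Real.exp (-(t * (ζ.1 ^ 2 + ζ.2 ^ 2)))) : ℝ) : ℂ) := by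
  have h := integral_prod_mul (μ := (volume : Measure ℝ)) (ν := (volume : Measure ℝ))
    (fun x : ℝ => (kerk x : ℂ) * Complex.exp (-(Complex.I * (x * (Real.sqrt t * ζ.1 : ℝ)))))
    (fun x : ℝ => (kerk x : ℂ) * Complex.exp (-(Complex.I * (x * (Real.sqrt t * ζ.2 : ℝ)))))
  have e : ∀ q : ℝ × ℝ, ((kerk q.1 : ℂ) * (kerk q.2 : ℂ)) *
      Complex.exp (-(Complex.I * ((Real.sqrt t * q.1 : ℝ) * ζ.1 + (Real.sqrt t * q.2 : ℝ) * ζ.2))) =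
      ((kerk q.1 : ℂ) * Complex.exp (-(Complex.I * (q.1 * (Real.sqrt t * ζ.1 : ℝ))))) *
      ((kerk q.2 : ℂ) * Complex.exp (-(Complex.I * (q.2 * (Real.sqrt t * ζ.2 : ℝ))))) := by
    intro q
    have : Complex.exp (-(Complex.I * ((Real.sqrt t * q.1 : ℝ) * ζ.1 + (Real.sqrt t * q.2 : ℝ) * ζ.2)))
      = Complex.exp (-(Complex.I * (q.1 * (Real.sqrt t * ζ.1 : ℝ)))) *
        Complex.exp (-(Complex.I * (q.2 * (Real.sqrt t * ζ.2 : ℝ)))) := by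
      rw [← Complex.exp_add]
      congr 1
      push_cast
      ring
    rw [this]
    ring
  simp_rw [e]
  rw [h]
  unfold kerk
  rw [aux_gauss_s18, aux_gauss_s18]
  have hs : ((Real.sqrt t : ℝ) : ℂ) * (Real.sqrt t : ℝ) = t := by
    rw [← Complex.ofReal_mul, Real.mul_self_sqrt ht]
  have hp : ((Real.sqrt Real.pi : ℝ) : ℂ) * (Real.sqrt Real.pi : ℝ) = Real.pi := by
    rw [← Complex.ofReal_mul, Real.mul_self_sqrt Real.pi_pos.le]
  have hexp : Complex.exp (-((Real.sqrt t * ζ.1 : ℝ) : ℂ) ^ 2) *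
      Complex.exp (-((Real.sqrt t * ζ.2 : ℝ) : ℂ) ^ 2) =
      Complex.exp (-(t * (ζ.1 ^ 2 + ζ.2 ^ 2))) := by
    rw [← Complex.exp_add]
    congr 1
    push_cast
    rw [← hs]
    ring
  push_cast at hexp ⊢
  rw [← hexp]
  have hI : Complex.I * Complex.I = -1 := Complex.I_mul_I
  linear_combination (16 * (Real.sqrt Real.pi : ℂ) * (Real.sqrt Real.pi : ℂ) * (Real.sqrt t : ℂ) * (Real.sqrt t : ℂ) * ζ.1 * ζ.2 * Complex.exp (-((Real.sqrt t : ℂ) * ζ.1) ^ 2) *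
      Complex.exp (-((Real.sqrt t : ℂ) * ζ.2) ^ 2)) * hI
    - (16 * (Real.sqrt t : ℂ) * (Real.sqrt t : ℂ) * ζ.1 * ζ.2 * Complex.exp (-((Real.sqrt t : ℂ) * ζ.1) ^ 2) *
      Complex.exp (-((Real.sqrt t : ℂ) * ζ.2) ^ 2)) * hp
    - (16 * (Real.pi : ℂ) * ζ.1 * ζ.2 * Complex.exp (-((Real.sqrt t : ℂ) * ζ.1) ^ 2) *
      Complex.exp (-((Real.sqrt t : ℂ) * ζ.2) ^ 2)) * hs

lemma ker_real (ε : ℝ) (hε : 0 < ε) (hε' : ε < 1) (r : ℝ) (hr : 0 < r) :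
    ∫ s in Set.Ioi (0:ℝ), ∫ v in Set.Ioi (0:ℝ),
      kerA ε s * (kerB ε v * ((s * (1 + v)) * Real.exp (-((s * (1 + v)) * r)))) =
    r ^ (ε / 2 - 1) * (1 + r) ^ (-ε) * (Real.Gamma (1 - ε / 2) * Real.Gamma ε) := by
  have h1 : ∀ s ∈ Set.Ioi (0:ℝ), ∫ v in Set.Ioi (0:ℝ),
      kerA ε s * (kerB ε v * ((s * (1 + v)) * Real.exp (-((s * (1 + v)) * r)))) =
      (r ^ (ε / 2 - 1) * Real.Gamma (1 - ε / 2)) * (s ^ (ε - 1) * Real.exp (-((1 + r) * s))) := by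
    intro s hs
    have hs : 0 < s := hs
    have e : ∀ v ∈ Set.Ioi (0:ℝ), 
        kerA ε s * (kerB ε v * ((s * (1 + v)) * Real.exp (-((s * (1 + v)) * r)))) =
        (s ^ (ε / 2) * Real.exp (-((1 + r) * s))) *
          (v ^ ((1 - ε / 2) - 1) * Real.exp (-((s * r) * v))) := by
      intro v hv
      have hv : 0 < v := hv
      have e1 : Real.exp (-((s * (1 + v)) * r)) * Real.exp (-s) =
          Real.exp (-((1 + r) * s)) * Real.exp (-((s * r) * v)) := by
        rw [← Real.exp_add, ← Real.exp_add]; congr 1; ring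
      unfold kerA kerB
      rw [Real.rpow_sub_one hs.ne', show 1 - ε / 2 - 1 = -(ε/2) by ring]
      have : (1 + v) ≠ 0 := by positivity
      trans s ^ (ε / 2) * v ^ (-(ε / 2)) * (Real.exp (-((s * (1 + v)) * r)) * Real.exp (-s))
      · field_simp
      · rw [e1]; ring
    rw [setIntegral_congr_fun measurableSet_Ioi e, integral_const_mul,
      Real.integral_rpow_mul_exp_neg_mul_Ioi (by linarith) (by positivity)]
    rw [one_div, Real.inv_rpow (by positivity), ← Real.rpow_neg (by positivity),
      Real.mul_rpow hs.le hr.le, show -(1 - ε / 2) = ε / 2 - 1 by ring]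
    have : s ^ (ε - 1) = s ^ (ε/2) * s ^ (ε / 2 - 1) := by
      rw [← Real.rpow_add hs]; congr 1; ring
    rw [this]
    ring
  rw [setIntegral_congr_fun measurableSet_Ioi h1, integral_const_mul,
    Real.integral_rpow_mul_exp_neg_mul_Ioi hε (by positivity), one_div, Real.inv_rpow (by positivity),
    ← Real.rpow_neg (by positivity)]
  ring

lemma ker_formula (ε : ℝ) (hε : 0 < ε) (hε' : ε < 1) (ζ : ℝ × ℝ) (hr : 0 < ζ.1 ^ 2 + ζ.2 ^ 2) :
    ∫ p, kerH ε p * Complex.exp (-(Complex.I * ((kery p).1 * ζ.1 + (kery p).2 * ζ.2))) ∂kermu =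
    ((-16 * Real.pi * (ζ.1 * ζ.2) * ((ζ.1 ^ 2 + ζ.2 ^ 2) ^ (ε / 2 - 1) *
      (1 + (ζ.1 ^ 2 + ζ.2 ^ 2)) ^ (-ε) * (Real.Gamma (1 - ε / 2) * Real.Gamma ε)) : ℝ) : ℂ) := by
  have hi := osc_int (kerH_int ε hε hε') kery kery_meas ζ
  unfold kermu at hi ⊢
  rw [integral_prod _ hi]
  rw [← ker_real ε hε hε' _ hr, ← integral_const_mul, ← integral_complex_ofReal]
  refine setIntegral_congr_fun measurableSet_Ioi fun s hs => ?_
  have hs : 0 < s := hs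
  have hi2 : Integrable (fun q : ℝ × ℝ × ℝ => kerH ε (s, q) *
      Complex.exp (-(Complex.I * ((kery (s, q)).1 * ζ.1 + (kery (s, q)).2 * ζ.2))))
      ((volume.restrict (Set.Ioi 0)).prod (volume.prod volume)) := by
    refine osc_int (f := fun q => kerH ε (s, q)) ?_ (fun q => kery (s, q)) ?_ ζ
    · exact ((kerB_int ε hε hε').ofReal (𝕜 := ℂ) |>.mul_prod
        (kerk_int.ofReal.mul_prod kerk_int.ofReal)).const_mul (kerA ε s : ℂ)
    · unfold kery; fun_prop
  rw [integral_prod _ hi2, ← integral_const_mul, ← integral_complex_ofReal]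
  refine setIntegral_congr_fun measurableSet_Ioi fun v hv => ?_
  have hv : 0 < v := hv
  have := ker_gauss2 (s * (1 + v)) (by positivity) ζ
  unfold kerH kery
  dsimp only
  simp_rw [mul_assoc ((kerA ε s : ℝ) : ℂ), mul_assoc ((kerB ε v : ℝ) : ℂ)]
  rw [integral_const_mul, integral_const_mul, this]
  push_cast
  ring

open scoped FourierTransform SchwartzMap

lemma ft2_eq (f : ℝ × ℝ → ℂ) (ζ : ℝ × ℝ) :
    ft2 f ζ = 𝓕 (fun w : ℂ => f (w.re, w.im)) ((2 * Real.pi)⁻¹ • (⟨ζ.1, ζ.2⟩ : ℂ)) := by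
  rw [Real.fourier_eq', ft2, ← Complex.volume_preserving_equiv_real_prod.integral_comp'
    (g := fun z : ℝ × ℝ => Complex.exp (-(Complex.I * (z.1 * ζ.1 + z.2 * ζ.2))) * f z)]
  congr 1 with w
  simp only [Complex.measurableEquivRealProd_apply, smul_eq_mul]
  congr 2
  rw [inner_smul_right]
  simp only [Complex.inner, Complex.mul_re, Complex.conj_re, Complex.conj_im]
  have := Real.pi_ne_zero
  have e : -2 * Real.pi * ((2 * Real.pi)⁻¹ * (ζ.1 * w.re - ζ.2 * -w.im)) =
    -(w.re * ζ.1 + w.im * ζ.2) := by field_simp; ring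
  rw [e]
  push_cast
  ring

lemma mult2_eq (σ : ℝ × ℝ → ℂ) (g : ℝ × ℝ → ℂ) (z : ℝ × ℝ) :
    mult2 σ g z = 𝓕⁻ (fun w : ℂ => σ (2 * Real.pi * w.re, 2 * Real.pi * w.im) *
      ft2 g (2 * Real.pi * w.re, 2 * Real.pi * w.im)) (⟨z.1, z.2⟩ : ℂ) := by
  rw [Real.fourierInv_eq', mult2, ← Complex.volume_preserving_equiv_real_prod.integral_comp'
    (g := fun ζ : ℝ × ℝ => Complex.exp (Complex.I * (z.1 * ζ.1 + z.2 * ζ.2)) * σ ζ * ft2 g ζ)]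
  have h := Measure.integral_comp_smul (volume : Measure ℂ) (fun w : ℂ =>
    Complex.exp (Complex.I * (z.1 * w.re + z.2 * w.im)) * σ (w.re, w.im) * ft2 g (w.re, w.im))
    (2 * Real.pi)
  simp only [Complex.measurableEquivRealProd_apply]
  have e : ((2 * Real.pi : ℂ) ^ 2)⁻¹ = ((|((2 * Real.pi) ^ Module.finrank ℝ ℂ)⁻¹| : ℝ) : ℂ) := by
    rw [Complex.finrank_real_complex, abs_of_nonneg (by positivity)]
    push_cast; rfl
  rw [e, ← Complex.real_smul, ← h]
  congr 1 with w
  simp only [Complex.smul_re, Complex.smul_im, smul_eq_mul, mul_assoc]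
  congr 2
  simp only [Complex.inner, Complex.mul_re, Complex.conj_re, Complex.conj_im]
  push_cast
  ring

/-- Schwartz function on `ℂ` with the Fourier transform of `jap`. -/
lemma exists_P (ε : ℝ) (f : SchwartzMap (ℝ × ℝ) ℂ) : ∃ P : SchwartzMap ℂ ℂ,
    ∀ w : ℂ, P w = (((1 + (2 * Real.pi * w.re)^2 + (2 * Real.pi * w.im)^2) ^ (2 * ε / 2) : ℝ) : ℂ) *
      ft2 f (2 * Real.pi * w.re, 2 * Real.pi * w.im) := by
  let f' : SchwartzMap ℂ ℂ :=
    SchwartzMap.compCLMOfContinuousLinearEquiv ℂ Complex.equivRealProdCLM f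
  have ht : (fun w : ℂ => (((1 + ‖(2 * Real.pi) • w‖ ^ 2) ^ ε : ℝ) : ℂ)).HasTemperateGrowth := by
    have h1 := Function.hasTemperateGrowth_one_add_norm_sq_rpow ℂ ε
    have h2 : (fun w : ℂ => (2 * Real.pi) • w).HasTemperateGrowth := by fun_prop
    have h3 := h1.comp h2
    have h4 : Complex.ofReal.HasTemperateGrowth := Complex.ofRealCLM.hasTemperateGrowth
    exact h4.comp h3
  refine ⟨SchwartzMap.smulLeftCLM ℂ
    (fun w : ℂ => (((1 + ‖(2 * Real.pi) • w‖ ^ 2) ^ ε : ℝ) : ℂ)) (𝓕 f'), fun w => ?_⟩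
  rw [SchwartzMap.smulLeftCLM_apply_apply ht, smul_eq_mul]
  congr 1
  · rw [Complex.sq_norm, Complex.normSq_apply]
    simp only [Complex.smul_re, Complex.smul_im, smul_eq_mul]
    congr 2
    · ring
    · ring
  · rw [ft2_eq, SchwartzMap.fourier_coe]
    have hf' : (fun w : ℂ => f (w.re, w.im)) = ⇑f' := rfl
    rw [hf']
    refine congrArg (𝓕 (⇑f' : ℂ → ℂ)) ?_
    have hpi := Real.pi_ne_zero
    apply Complex.ext
    · simp; field_simp
    · simp; field_simp

lemma ft2_jap (ε : ℝ) (f : SchwartzMap (ℝ × ℝ) ℂ) (ζ : ℝ × ℝ) :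
    ft2 (jap (2 * ε) f) ζ = (((1 + ζ.1^2 + ζ.2^2) ^ (2 * ε / 2) : ℝ) : ℂ) * ft2 f ζ := by
  obtain ⟨P, hP⟩ := exists_P ε f
  have h : (fun w : ℂ => jap (2 * ε) f (w.re, w.im)) = ⇑(𝓕⁻ P : SchwartzMap ℂ ℂ) := by
    ext w
    rw [jap, mult2_eq, SchwartzMap.fourierInv_coe]
    have hPe : (⇑P : ℂ → ℂ) = _ := funext hP
    rw [hPe]
  rw [ft2_eq, h, ← SchwartzMap.fourier_coe, FourierTransform.fourier_fourierInv_eq, hP]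
  have hpi := Real.pi_ne_zero
  have e1 : 2 * Real.pi * ((2 * Real.pi)⁻¹ • (⟨ζ.1, ζ.2⟩ : ℂ)).re = ζ.1 := by
    simp; field_simp
  have e2 : 2 * Real.pi * ((2 * Real.pi)⁻¹ • (⟨ζ.1, ζ.2⟩ : ℂ)).im = ζ.2 := by
    simp; field_simp
  rw [e1, e2]

lemma exists_Q (ε : ℝ) (f : SchwartzMap (ℝ × ℝ) ℂ) : ∃ Q : SchwartzMap (ℝ × ℝ) ℂ,
    ∀ ζ, Q ζ = (((1 + ζ.1^2 + ζ.2^2) ^ (2 * ε / 2) : ℝ) : ℂ) * ft2 f ζ := by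
  obtain ⟨P, hP⟩ := exists_P ε f
  let L : (ℝ × ℝ) ≃L[ℝ] ℂ := Complex.equivRealProdCLM.symm.trans
    (ContinuousLinearEquiv.smulLeft (Units.mk0 (2 * Real.pi)⁻¹ (by positivity)))
  refine ⟨SchwartzMap.compCLMOfContinuousLinearEquiv ℂ L P, fun ζ => ?_⟩
  have hpi := Real.pi_ne_zero
  have hL : L ζ = (2 * Real.pi)⁻¹ • (⟨ζ.1, ζ.2⟩ : ℂ) := rfl
  have e1 : 2 * Real.pi * ((2 * Real.pi)⁻¹ • (⟨ζ.1, ζ.2⟩ : ℂ)).re = ζ.1 := by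
    simp; field_simp
  have e2 : 2 * Real.pi * ((2 * Real.pi)⁻¹ • (⟨ζ.1, ζ.2⟩ : ℂ)).im = ζ.2 := by
    simp; field_simp
  rw [SchwartzMap.compCLMOfContinuousLinearEquiv_apply, Function.comp_apply, hP, hL, e1, e2]

lemma sing_int (ε : ℝ) (hε : 0 < ε) (hε' : ε < 1) :
    Integrable (fun x : ℝ => |x| ^ (-ε) * (1 + x ^ 2)⁻¹) := by
  have h0 : IntegrableOn (fun x : ℝ => |x| ^ (-ε)) (Set.Ioo (-1) 1) := by
    have h1 := intervalIntegral.intervalIntegrable_rpow' (r := -ε) (a := 0) (b := 1) (by linarith)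
    have h2 : IntervalIntegrable (fun x : ℝ => |x| ^ (-ε)) volume 0 1 :=
      h1.congr (by
        intro x hx
        rw [Set.uIoc_of_le zero_le_one] at hx
        simp only
        rw [abs_of_pos hx.1])
    have h3 : IntervalIntegrable (fun x : ℝ => |x| ^ (-ε)) volume (-1) 0 := by
      have := (IntervalIntegrable.iff_comp_neg (f := fun x : ℝ => |x| ^ (-ε))).1 h2
      simp only [abs_neg, neg_zero] at this
      exact this.symm
    have h4 := (intervalIntegrable_iff_integrableOn_Ioc_of_le (by norm_num)).1 (h3.trans h2)
    exact h4.mono_set Set.Ioo_subset_Ioc_self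
  have hm : Measurable (fun x : ℝ => |x| ^ (-ε) * (1 + x ^ 2)⁻¹) := by fun_prop
  have hs : MeasurableSet (Set.Ioo (-1:ℝ) 1) := measurableSet_Ioo
  rw [← integrableOn_univ, ← Set.union_compl_self (Set.Ioo (-1:ℝ) 1)]
  refine IntegrableOn.union ?_ ?_
  · refine Integrable.mono' h0 hm.aestronglyMeasurable (Filter.Eventually.of_forall fun x => ?_)
    rw [Real.norm_of_nonneg (by positivity)]
    refine mul_le_of_le_one_right (by positivity) (inv_le_one_of_one_le₀ ?_)
    nlinarith [sq_nonneg x]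
  · refine Integrable.mono' integrable_inv_one_add_sq.integrableOn hm.aestronglyMeasurable ?_
    refine (ae_restrict_iff' hs.compl).2 (Filter.Eventually.of_forall fun x hx => ?_)
    rw [Real.norm_of_nonneg (by positivity)]
    refine mul_le_of_le_one_left (by positivity) ?_
    refine Real.rpow_le_one_of_one_le_of_nonpos ?_ (by linarith)
    by_contra h
    exact hx (abs_lt.1 (not_le.1 h))

lemma g_int (ε : ℝ) (hε : 0 < ε) (hε' : ε < 1) (Q : SchwartzMap (ℝ × ℝ) ℂ) :
    Integrable (fun ζ : ℝ × ℝ => (((ζ.1^2 + ζ.2^2) ^ (-ε/2) : ℝ) : ℂ) * Q ζ) := by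
  obtain ⟨C0, hC0, h0⟩ := Q.decay 0 0
  obtain ⟨C4, hC4, h4⟩ := Q.decay 4 0
  simp only [norm_iteratedFDeriv_zero] at h0 h4
  have hb := ((sing_int ε hε hε').mul_prod integrable_inv_one_add_sq).const_mul (2 * C0 + 2 * C4)
  refine Integrable.mono' hb ?_ ?_
  · refine AEStronglyMeasurable.mul ?_ Q.continuous.aestronglyMeasurable
    apply Measurable.aestronglyMeasurable
    fun_prop
  · have hne : ∀ᵐ ζ : ℝ × ℝ, ζ.1 ≠ 0 := by
      have h1 : ∀ᵐ x : ℝ, x ≠ 0 := by simp [ae_iff]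
      exact Measure.quasiMeasurePreserving_fst.ae h1
    filter_upwards [hne] with ζ hζ
    have h0 := h0 ζ
    have h4 := h4 ζ
    rw [norm_mul, Complex.norm_real, Real.norm_of_nonneg (by positivity)]
    have a1 : (ζ.1^2 + ζ.2^2) ^ (-ε/2) ≤ |ζ.1| ^ (-ε) := by
      have : |ζ.1| ^ (-ε) = (ζ.1 ^ 2) ^ (-ε/2) := by
        rw [← sq_abs, ← Real.rpow_natCast, ← Real.rpow_mul (abs_nonneg _)]
        congr 1; push_cast; ring
      rw [this]
      refine Real.rpow_le_rpow_of_nonpos (by positivity) (by nlinarith [sq_nonneg ζ.2]) (by linarith)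
    have a2 : ‖Q ζ‖ ≤ (2 * C0 + 2 * C4) * ((1 + ζ.1 ^ 2)⁻¹ * (1 + ζ.2 ^ 2)⁻¹) := by
      rw [← mul_inv, ← div_eq_mul_inv, le_div_iff₀ (by positivity)]
      have n1 : ζ.1 ^ 2 ≤ ‖ζ‖ ^ 2 := by
        rw [← sq_abs]; gcongr; exact norm_fst_le ζ
      have n2 : ζ.2 ^ 2 ≤ ‖ζ‖ ^ 2 := by
        rw [← sq_abs]; gcongr; exact norm_snd_le ζ
      have n3 : (1 + ζ.1 ^ 2) * (1 + ζ.2 ^ 2) ≤ 2 + 2 * ‖ζ‖ ^ 4 := by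
        have : (1 + ζ.1 ^ 2) * (1 + ζ.2 ^ 2) ≤ (1 + ‖ζ‖ ^ 2) * (1 + ‖ζ‖ ^ 2) := by gcongr
        nlinarith [sq_nonneg (1 - ‖ζ‖ ^ 2)]
      calc ‖Q ζ‖ * ((1 + ζ.1 ^ 2) * (1 + ζ.2 ^ 2)) ≤ ‖Q ζ‖ * (2 + 2 * ‖ζ‖ ^ 4) := by gcongr
        _ ≤ _ := by simp only [pow_zero, one_mul] at h0; nlinarith
    calc _ ≤ |ζ.1| ^ (-ε) * ((2 * C0 + 2 * C4) * ((1 + ζ.1 ^ 2)⁻¹ * (1 + ζ.2 ^ 2)⁻¹)) := by gcongr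
      _ = _ := by ring

/-- For every `0 < ε < 1` there is `C > 0` such that for every Schwartz
`f : ℝ² → ℂ`, `‖R f‖_{L¹(ℝ²)} ≤ C ‖|∇|^{-ε} ⟨∇⟩^{2ε} f‖_{L¹(ℝ²)}` in `[0,∞]`. -/
theorem riesz_L1_bound (ε : ℝ) (hε : 0 < ε) (hε' : ε < 1) :
    ∃ C : ℝ, 0 < C ∧ ∀ f : SchwartzMap (ℝ × ℝ) ℂ,
      (∫⁻ z : ℝ × ℝ, (‖riesz (⇑f) z‖₊ : ℝ≥0∞)) ≤
        ENNReal.ofReal C * ∫⁻ z : ℝ × ℝ, (‖homog (-ε) (jap (2 * ε) ⇑f) z‖₊ : ℝ≥0∞) := by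
  set D : ℝ := -16 * Real.pi * (Real.Gamma (1 - ε / 2) * Real.Gamma ε) with hD
  have hG1 : 0 < Real.Gamma (1 - ε / 2) := Real.Gamma_pos_of_pos (by linarith)
  have hG2 : 0 < Real.Gamma ε := Real.Gamma_pos_of_pos hε
  have hD0 : D ≠ 0 := by
    have : 0 < Real.pi * (Real.Gamma (1 - ε / 2) * Real.Gamma ε) := by positivity
    rw [hD]; nlinarith
  have hHi : Integrable (fun p => (D : ℂ)⁻¹ * kerH ε p) kermu :=
    (kerH_int ε hε hε').const_mul _
  have : SFinite kermu := by unfold kermu; infer_instance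
  set N := ∫⁻ p, ‖(D : ℂ)⁻¹ * kerH ε p‖ₑ ∂kermu with hN
  have hNfin : N ≠ ⊤ := hHi.hasFiniteIntegral.ne
  refine ⟨N.toReal + 1, by positivity, fun f => ?_⟩
  obtain ⟨Q, hQ⟩ := exists_Q ε f
  set g : ℝ × ℝ → ℂ := fun ζ => (((ζ.1^2 + ζ.2^2) ^ (-ε/2) : ℝ) : ℂ) * Q ζ with hg
  have hgi : Integrable g := g_int ε hε hε' Q
  have key := aux_L1 kermu _ hHi kery kery_meas g hgi
  have hh : ∀ z, homog (-ε) (jap (2 * ε) f) z = ((2 * Real.pi : ℂ) ^ 2)⁻¹ *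
      ∫ ζ : ℝ × ℝ, Complex.exp (Complex.I * (z.1 * ζ.1 + z.2 * ζ.2)) * g ζ := by
    intro z
    rw [homog, mult2]
    congr 2 with ζ
    rw [ft2_jap, ← hQ, hg, mul_assoc]
  have hr : ∀ z, riesz f z = ((2 * Real.pi : ℂ) ^ 2)⁻¹ *
      ∫ ζ : ℝ × ℝ, Complex.exp (Complex.I * (z.1 * ζ.1 + z.2 * ζ.2)) *
      ((∫ x, ((D : ℂ)⁻¹ * kerH ε x) *
        Complex.exp (-(Complex.I * ((kery x).1 * ζ.1 + (kery x).2 * ζ.2))) ∂kermu) * g ζ) := by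
    intro z
    rw [riesz, mult2]
    congr 2 with ζ
    rw [mul_assoc]
    congr 1
    simp_rw [mul_assoc, integral_const_mul]
    rcases (add_nonneg (sq_nonneg ζ.1) (sq_nonneg ζ.2)).eq_or_lt with h0 | hpos
    · have hz : (-ε/2) ≠ 0 := by linarith
      simp only [hg]
      rw [← h0, Real.zero_rpow hz]
      simp
    · rw [ker_formula ε hε hε' ζ hpos]
      simp only [hg, hQ]
      rw [← mul_assoc, ← mul_assoc, ← mul_assoc]
      congr 1
      set r := ζ.1 ^ 2 + ζ.2 ^ 2 with hrdef
      have e1 : r ^ (ε / 2 - 1) = r ^ (ε/2) / r := Real.rpow_sub_one hpos.ne' _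
      have e2 : r ^ (-ε/2) = (r ^ (ε/2))⁻¹ := by rw [neg_div, Real.rpow_neg hpos.le]
      have e3 : (1 + ζ.1 ^ 2 + ζ.2 ^ 2) = 1 + r := by rw [hrdef]; ring
      have e4 : (1 + r) ^ (-ε) = ((1 + r) ^ ε)⁻¹ := Real.rpow_neg (by positivity) _
      have e5 : 2 * ε / 2 = ε := by ring
      have p1 : r ^ (ε/2) ≠ 0 := (Real.rpow_pos_of_pos hpos _).ne'
      have p2 : (1 + r) ^ ε ≠ 0 := (Real.rpow_pos_of_pos (by positivity) _).ne'
      rw [e3, e5, e4, e1, e2]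
      have hr0 := hpos.ne'
      have hpi := Real.pi_ne_zero
      have hreal : ζ.1 * ζ.2 / r = D⁻¹ * (-16 * Real.pi * (ζ.1 * ζ.2) * (r ^ (ε / 2) / r *
          ((1 + r) ^ ε)⁻¹ * (Real.Gamma (1 - ε / 2) * Real.Gamma ε))) * (r ^ (ε / 2))⁻¹ *
          (1 + r) ^ ε := by
        have : -16 * Real.pi * (ζ.1 * ζ.2) * (r ^ (ε / 2) / r *
          ((1 + r) ^ ε)⁻¹ * (Real.Gamma (1 - ε / 2) * Real.Gamma ε)) =
          D * ((ζ.1 * ζ.2) * (r ^ (ε / 2) / r * ((1 + r) ^ ε)⁻¹)) := by rw [hD]; ring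
        rw [this]
        field_simp
      rw [hreal]
      push_cast
      ring
  have hc : ENNReal.ofReal (N.toReal + 1) ≥ N := by
    rw [ge_iff_le, ← ENNReal.ofReal_toReal hNfin, ENNReal.toReal_ofReal (by positivity)]
    exact ENNReal.ofReal_le_ofReal (by linarith)
  change ∫⁻ z : ℝ × ℝ, ‖riesz (⇑f) z‖ₑ ≤
    _ * ∫⁻ z : ℝ × ℝ, ‖homog (-ε) (jap (2 * ε) ⇑f) z‖ₑ
  simp_rw [hh, hr, enorm_mul]
  rw [lintegral_const_mul' _ _ enorm_ne_top, lintegral_const_mul' _ _ enorm_ne_top,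
    mul_left_comm]
  gcongr
  exact key.trans (by gcongr)

end
end
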